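/- arXiv:1709.03121 — 4 statements merged into one kernel-verified Lean document; each statement's English description precedes it below -/
import Mathlib

section
/- There exist functions mem: ℕ² → ℕ and α: ℕ⁴ → ℕ such that for every B-parity game with k counters and d+1 colours over a thin tree arena of width W with initial vertex v₀ such that val(v₀) is finite, Eve has a strategy using W·3^k·k!·mem(d,k) memory states that ensures B(val(v₀)^k · α(d,k,W,val(v₀))) ∩ Parity(Ω) from v₀. -/
/-- A counter action: leave unchanged, increment, or reset. -/
inductive CAct : Type
  | eps
  | inc
  | reset
  deriving DecidableEq

/-- Effect of one counter action on a counter value. -/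
def updC : ℕ → CAct → ℕ
  | c, .eps => c
  | c, .inc => c + 1
  | _, .reset => 0

/-- An arena with vertices `V`, edges `E` and `k` counters: each edge has a
source, a target and a counter action in `{ε,i,r}^k`; `eve` is the set of
vertices controlled by Eve. -/
structure Arena (V E : Type) (k : ℕ) where
  src : E → V
  tgt : E → V
  act : E → Fin k → CAct
  eve : V → Prop

namespace Arena

variable {V E : Type} {k : ℕ}

/-- An infinite play, as a sequence of consecutive edges. -/
def IsPath (A : Arena V E k) (π : ℕ → E) : Prop :=
  ∀ n, A.tgt (π n) = A.src (π (n + 1))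

/-- Value of counter `j` after `n` steps of the play `π` (counters start at 0). -/
def cval (A : Arena V E k) (π : ℕ → E) (j : Fin k) : ℕ → ℕ
  | 0 => 0
  | n + 1 => updC (A.cval π j n) (A.act (π n) j)

/-- The condition `B(N)`: all counter values stay at most `N` along the play. -/
def BoundedBy (A : Arena V E k) (π : ℕ → E) (N : ℕ) : Prop :=
  ∀ (j : Fin k) (n : ℕ), A.cval π j n ≤ N

end Arena

/-- A strategy for Eve with memory `M`: an initial memory state, a memory
update function reading edges, and a next-move function. -/
structure Strategy (V E M : Type) where
  init : M
  update : M → E → M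
  move : V → M → E

namespace Strategy

variable {V E M : Type} {k : ℕ}

/-- Memory state after `n` steps of the play `π`. -/
def memAt (S : Strategy V E M) (π : ℕ → E) : ℕ → M
  | 0 => S.init
  | n + 1 => S.update (S.memAt π n) (π n)

/-- A play is consistent with a strategy if every move from an Eve vertex is
the one chosen by the strategy. -/
def Consistent (A : Arena V E k) (S : Strategy V E M) (π : ℕ → E) : Prop :=
  ∀ n, A.eve (A.src (π n)) → π n = S.move (A.src (π n)) (S.memAt π n)

/-- A strategy is valid if, at every Eve vertex having an outgoing edge, it
picks an outgoing edge of that vertex. -/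
def Valid (A : Arena V E k) (S : Strategy V E M) : Prop :=
  ∀ v m, A.eve v → (∃ e, A.src e = v) → A.src (S.move v m) = v

end Strategy

/-- A strategy ensures a condition from `v₀` if every play from `v₀`
consistent with it satisfies the condition. -/
def Ensures {V E M : Type} {k : ℕ} (A : Arena V E k) (S : Strategy V E M)
    (v₀ : V) (Wc : (ℕ → E) → Prop) : Prop :=
  ∀ π : ℕ → E, A.src (π 0) = v₀ → A.IsPath π → S.Consistent A π → Wc π

/-- A property of positions holds infinitely often. -/
def InfOften (p : ℕ → Prop) : Prop := ∀ n, ∃ m, n ≤ m ∧ p m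

/-- The parity condition: the maximal colour seen infinitely often is even. -/
def ParityPlay {V E : Type} {k : ℕ} (A : Arena V E k) (Ω : V → ℕ) (π : ℕ → E) : Prop :=
  ∃ c, Even c ∧ InfOften (fun n => Ω (A.src (π n)) = c) ∧
    ∀ c', c < c' → ¬ InfOften (fun n => Ω (A.src (π n)) = c')

/-- The finite prefix of length `n` of an infinite branch `b`. -/
def prefixOf (b : ℕ → Bool) (n : ℕ) : List Bool := List.ofFn fun i : Fin n => b i

open Relation

/-! ### Infinite paths in a graph -/

section Paths

variable {X : Type*}

theorem exists_seq_of_forall_exists (r : X → X → Prop) (p : X → Prop)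
    (h : ∀ x, p x → ∃ y, p y ∧ r x y) (x₀ : X) (hx₀ : p x₀) :
    ∃ f : ℕ → X, f 0 = x₀ ∧ ∀ n, p (f n) ∧ r (f n) (f (n + 1)) := by
  choose g hg using fun x : {x // p x} => h x.1 x.2
  let F : ℕ → {x // p x} := fun n => Nat.rec ⟨x₀, hx₀⟩ (fun _ x => ⟨g x, (hg x).1⟩) n
  exact ⟨fun n => (F n).1, rfl, fun n => ⟨(F n).2, (hg (F n)).2⟩⟩

theorem eventually_const_of_antitone {α : Type*} [LinearOrder α] [WellFoundedLT α]
    (f : ℕ → α) (n₀ : ℕ) (h : ∀ n, n₀ ≤ n → f (n + 1) ≤ f n) :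
    ∃ n₁, n₀ ≤ n₁ ∧ ∀ n, n₁ ≤ n → f n = f n₁ := by
  have hanti : ∀ a b, n₀ ≤ a → a ≤ b → f b ≤ f a := by
    intro a b ha hab
    induction b, hab using Nat.le_induction with
    | base => exact le_rfl
    | succ b hab ih => exact (h b (ha.trans hab)).trans ih
  obtain ⟨_, ⟨n₁, hn₁, rfl⟩, hmin⟩ := (wellFounded_lt (α := α)).has_min (f '' {n | n₀ ≤ n})
    ⟨f n₀, n₀, le_refl n₀, rfl⟩
  exact ⟨n₁, hn₁, fun n hn => le_antisymm (hanti n₁ n hn₁ hn)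
    (not_lt.1 (hmin (f n) ⟨n, le_trans hn₁ hn, rfl⟩))⟩

/-- `y` is reached from `x` by a nonempty path whose last edge leaves a bad node. -/
def ReachesThrough (step : X → X → Prop) (bad : X → Prop) (x y : X) : Prop :=
  ∃ z, ReflTransGen step x z ∧ bad z ∧ step z y

/-- Some path of length `n` from `x` ends in `q`. -/
def ReachesIn (step : X → X → Prop) (q : X → Prop) : ℕ → X → Prop
  | 0, x => q x
  | n + 1, x => ∃ y, step x y ∧ ReachesIn step q n y

/-- Every infinite path visits only finitely many bad nodes. -/
def FinitelyBad (step : X → X → Prop) (bad : X → Prop) : Prop :=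
  ∀ f : ℕ → X, (∀ n, step (f n) (f (n + 1))) → ∃ n, ∀ m, n ≤ m → ¬ bad (f m)

theorem exists_reachesIn {step : X → X → Prop} {q : X → Prop} {x z : X}
    (h : ReflTransGen step x z) (hz : q z) : ∃ n, ReachesIn step q n x := by
  induction h using ReflTransGen.head_induction_on with
  | refl => exact ⟨0, hz⟩
  | head hab _ ih =>
    obtain ⟨n, hn⟩ := ih
    exact ⟨n + 1, _, hab, hn⟩

theorem FinitelyBad.wellFounded {step : X → X → Prop} {bad : X → Prop}
    (h : FinitelyBad step bad) : WellFounded fun y x => ReachesThrough step bad x y := by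
  by_contra hwf
  have hnext : ∀ x, ¬ Acc (fun y x => ReachesThrough step bad x y) x →
      ∃ y, ¬ Acc (fun y x => ReachesThrough step bad x y) y ∧ ReachesThrough step bad x y := by
    intro x hx
    by_contra hcon
    push Not at hcon
    exact hx (Acc.intro x fun y hy => by
      by_contra hy'
      exact hcon y hy' hy)
  let q : X → Prop := fun x => bad x ∧
    ∃ y, ¬ Acc (fun y x => ReachesThrough step bad x y) y ∧ step x y
  have hacc : ∀ x, ¬ Acc (fun y x => ReachesThrough step bad x y) x →
      ∃ n, ReachesIn step q n x := by
    intro x hx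
    obtain ⟨y, hy, z, hxz, hz, hzy⟩ := hnext x hx
    exact exists_reachesIn hxz ⟨hz, y, hy, hzy⟩
  obtain ⟨x₀, hx₀⟩ : ∃ x, ¬ Acc (fun y x => ReachesThrough step bad x y) x := by
    by_contra hcon
    push Not at hcon
    exact hwf ⟨hcon⟩
  obtain ⟨n₀, hn₀⟩ := hacc x₀ hx₀
  obtain ⟨f, -, hf⟩ := exists_seq_of_forall_exists
    (fun s t : X × ℕ => step s.1 t.1 ∧ (bad s.1 ∨ t.2 < s.2))
    (fun s => ReachesIn step q s.2 s.1) (by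
      rintro ⟨x, n⟩ hx
      cases n with
      | zero =>
        obtain ⟨hb, y, hy, hxy⟩ := hx
        obtain ⟨n', hn'⟩ := hacc y hy
        exact ⟨(y, n'), hn', hxy, Or.inl hb⟩
      | succ n =>
        obtain ⟨y, hxy, hy⟩ := hx
        exact ⟨(y, n), hy, hxy, Or.inr (Nat.lt_succ_self n)⟩) (x₀, n₀) hn₀
  obtain ⟨m, hm⟩ := h (fun n => (f n).1) fun n => (hf n).2.1
  have hdec : ∀ i, (f (m + i)).2 + i ≤ (f m).2 := by
    intro i
    induction i with
    | zero => simp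
    | succ i ih =>
      rcases (hf (m + i)).2.2 with hb | hlt
      · exact absurd hb (hm _ (by omega))
      · have e : m + (i + 1) = m + i + 1 := rfl
        rw [e]
        omega
  have := hdec ((f m).2 + 1)
  omega

/-- On every path from `x` a good node or the end of the path comes within `n` steps. -/
def FulfilledIn (step : X → X → Prop) (good : X → Prop) : ℕ → X → Prop
  | 0, x => good x
  | n + 1, x => good x ∨ ∀ y, step x y → FulfilledIn step good n y

theorem FulfilledIn.mono {step : X → X → Prop} {good : X → Prop} {n m : ℕ} {x : X}
    (h : FulfilledIn step good n x) (hnm : n ≤ m) : FulfilledIn step good m x := by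
  induction m generalizing n x with
  | zero =>
    obtain rfl : n = 0 := by omega
    exact h
  | succ m ih =>
    cases n with
    | zero => exact Or.inl h
    | succ n => exact h.imp id fun h y hy => ih (h y hy) (by omega)

theorem exists_fulfilledIn {step : X → X → Prop} {good : X → Prop}
    (hfin : ∀ x, {y | step x y}.Finite)
    (h : ∀ f : ℕ → X, (∀ n, step (f n) (f (n + 1))) → ∃ n, good (f n)) (x : X) :
    ∃ n, FulfilledIn step good n x := by
  by_contra hx
  obtain ⟨f, -, hf⟩ := exists_seq_of_forall_exists step
    (fun x => ¬ ∃ n, FulfilledIn step good n x) (by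
      intro x hx
      by_contra hcon
      push Not at hcon
      have hall : ∀ y, step x y → ∃ n, FulfilledIn step good n y := fun y hy => by
        by_contra hy'
        exact hcon y (by simpa using hy') hy
      choose! g hg using hall
      obtain ⟨n, hn⟩ := ((hfin x).image g).bddAbove
      exact hx ⟨n + 1, Or.inr fun y hy => (hg y hy).mono (hn ⟨y, hy, rfl⟩)⟩) x hx
  obtain ⟨n, hn⟩ := h f fun n => (hf n).2
  exact (hf n).1 ⟨0, hn⟩

/-! ### Bounded co-Büchi ranks on graphs of bounded width -/

/-- Nodes from which every infinite path enters `s`. -/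
def Inevitable (step : X → X → Prop) (s : X → Prop) (x : X) : Prop :=
  ∀ f : ℕ → X, f 0 = x → (∀ n, step (f n) (f (n + 1))) → ∃ n, s (f n)

/-- The `i`-th stage of the co-Büchi ranking construction. -/
def rankStage (step : X → X → Prop) (bad : X → Prop) : ℕ → X → Prop
  | 0, _ => False
  | i + 1, x => ∀ y, ReflTransGen step x y → bad y → Inevitable step (rankStage step bad i) y

variable {step : X → X → Prop} {bad : X → Prop}

theorem rankStage_of_step {i : ℕ} {x y : X} (hx : rankStage step bad i x) (hxy : step x y) :
    rankStage step bad i y := by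
  cases i with
  | zero => exact hx
  | succ i => exact fun z hz => hx z (ReflTransGen.head hxy hz)

theorem Inevitable.of_step {s : X → Prop} (hs : ∀ x y, s x → step x y → s y) {x y : X}
    (hx : Inevitable step s x) (hxy : step x y) : Inevitable step s y := by
  intro f hf0 hf
  obtain ⟨n, hn⟩ := hx (fun n => Nat.casesOn n x f) rfl (by
    rintro (_ | n)
    · simpa [hf0] using hxy
    · exact hf n)
  cases n with
  | zero => exact ⟨0, hf0 ▸ hs x y hn hxy⟩
  | succ n => exact ⟨n, hn⟩

theorem rankStage_succ_of_inevitable {i : ℕ} {x : X}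
    (hx : Inevitable step (rankStage step bad i) x) : rankStage step bad (i + 1) x := by
  intro y hxy hy
  clear hy
  induction hxy with
  | refl => exact hx
  | tail _ hyz ih => exact ih.of_step (fun _ _ => rankStage_of_step) hyz

theorem rankStage_succ {i : ℕ} {x : X} (hx : rankStage step bad i x) :
    rankStage step bad (i + 1) x :=
  rankStage_succ_of_inevitable fun _ hf0 _ => ⟨0, hf0 ▸ hx⟩

theorem exists_path_of_not_inevitable {s : X → Prop} {x : X} (hx : ¬ Inevitable step s x) :
    ∃ f : ℕ → X, f 0 = x ∧ (∀ n, step (f n) (f (n + 1))) ∧ ∀ n, ¬ s (f n) := by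
  unfold Inevitable at hx
  push Not at hx
  exact hx

variable {ι : Type*} {sp : X → ι} {lev : X → ℕ} {w : ℕ}

theorem exists_width_rankStage (hbad : FinitelyBad step bad)
    (hsp : ∀ x y, step x y → sp y = sp x) (hlev : ∀ x y, step x y → lev y = lev x + 1)
    (hfin : ∀ s l, {x | sp x = s ∧ lev x = l}.Finite)
    (hw : ∀ s l, {x | sp x = s ∧ lev x = l}.ncard ≤ w) (s : ι) (i : ℕ) :
    ∃ L, ∀ l, L ≤ l →
      {x | (sp x = s ∧ lev x = l) ∧ ¬ rankStage step bad i x}.ncard ≤ w - i := by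
  induction i with
  | zero =>
    exact ⟨0, fun l _ => (Set.ncard_le_ncard (fun x hx => hx.1) (hfin s l)).trans (hw s l)⟩
  | succ i ih =>
    obtain ⟨L, hL⟩ := ih
    by_cases hne : ∃ x, sp x = s ∧ ¬ Inevitable step (rankStage step bad i) x
    · obtain ⟨x, ⟨hxs, hx⟩, hmin⟩ := hbad.wellFounded.has_min
        {x | sp x = s ∧ ¬ Inevitable step (rankStage step bad i) x} hne
      have hx' : rankStage step bad (i + 1) x := by
        intro y hxy hy
        by_contra hyI
        obtain ⟨f, hf0, hf, hfs⟩ := exists_path_of_not_inevitable hyI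
        refine hmin (f 1) ⟨?_, fun hI => ?_⟩ ⟨y, hxy, hy, hf0 ▸ hf 0⟩
        · rw [hsp _ _ (hf 0), hf0, ← hxs]
          clear hmin hyI hy hf0
          induction hxy with
          | refl => rfl
          | tail _ h ih => rw [hsp _ _ h, ih]
        · obtain ⟨n, hn⟩ := hI (fun n => f (n + 1)) rfl fun n => hf (n + 1)
          exact hfs _ hn
      obtain ⟨f, hf0, hf, hfs⟩ := exists_path_of_not_inevitable hx
      have hfx : ∀ n, sp (f n) = s ∧ lev (f n) = lev x + n ∧
          rankStage step bad (i + 1) (f n) := by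
        intro n
        induction n with
        | zero => exact ⟨hf0 ▸ hxs, by rw [hf0, add_zero], hf0 ▸ hx'⟩
        | succ n ih =>
          exact ⟨(hsp _ _ (hf n)).trans ih.1, by rw [hlev _ _ (hf n), ih.2.1, add_assoc],
            rankStage_of_step ih.2.2 (hf n)⟩
      refine ⟨max L (lev x), fun l hl => ?_⟩
      have hlt : {x | (sp x = s ∧ lev x = l) ∧ ¬ rankStage step bad (i + 1) x}.ncard <
          {x | (sp x = s ∧ lev x = l) ∧ ¬ rankStage step bad i x}.ncard := by
        refine Set.ncard_lt_ncard (Set.ssubset_iff_exists.2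
          ⟨fun z hz => ⟨hz.1, fun h => hz.2 (rankStage_succ h)⟩, f (l - lev x), ?_, ?_⟩)
          ((hfin s l).subset fun z hz => hz.1)
        · exact ⟨⟨(hfx _).1, by rw [(hfx _).2.1]; omega⟩, hfs _⟩
        · exact fun h => h.2 (hfx _).2.2
      have := hL l (by omega)
      omega
    · push Not at hne
      refine ⟨0, fun l _ => ?_⟩
      have : {x | (sp x = s ∧ lev x = l) ∧ ¬ rankStage step bad (i + 1) x} = ∅ := by
        ext x
        simp only [Set.mem_ofPred_eq, Set.mem_empty_iff_false, iff_false, not_and, not_not]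
        exact fun hx => rankStage_succ_of_inevitable (hne x hx.1)
      simp [this]

theorem rankStage_eq_univ (hbad : FinitelyBad step bad)
    (hsp : ∀ x y, step x y → sp y = sp x) (hlev : ∀ x y, step x y → lev y = lev x + 1)
    (hfin : ∀ s l, {x | sp x = s ∧ lev x = l}.Finite)
    (hw : ∀ s l, {x | sp x = s ∧ lev x = l}.ncard ≤ w) (x : X) :
    rankStage step bad (w + 1) x := by
  refine rankStage_succ_of_inevitable fun f hf0 hf => ?_
  obtain ⟨L, hL⟩ := exists_width_rankStage hbad hsp hlev hfin hw (sp x) w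
  have hfx : ∀ n, sp (f n) = sp x ∧ lev (f n) = lev x + n := by
    intro n
    induction n with
    | zero => exact ⟨by rw [hf0], by rw [hf0, add_zero]⟩
    | succ n ih =>
      exact ⟨(hsp _ _ (hf n)).trans ih.1, by rw [hlev _ _ (hf n), ih.2, add_assoc]⟩
  refine ⟨L, ?_⟩
  by_contra hcon
  have h0 := hL (lev x + L) (by omega)
  rw [Nat.sub_self, Nat.le_zero, Set.ncard_eq_zero ((hfin _ _).subset fun z hz => hz.1)] at h0
  have hmem : f L ∈ {y | (sp y = sp x ∧ lev y = lev x + L) ∧ ¬ rankStage step bad w y} :=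
    ⟨hfx L, hcon⟩
  rw [h0] at hmem
  exact hmem

open Classical in
/-- On a graph of width `w` in which every infinite path is bad only finitely often there is a
ranking by numbers up to `2 * w + 1` that never increases, is even at bad nodes, and is odd
somewhere on every infinite path. -/
theorem FinitelyBad.exists_rank (hbad : FinitelyBad step bad)
    (hsp : ∀ x y, step x y → sp y = sp x) (hlev : ∀ x y, step x y → lev y = lev x + 1)
    (hfin : ∀ s l, {x | sp x = s ∧ lev x = l}.Finite)
    (hw : ∀ s l, {x | sp x = s ∧ lev x = l}.ncard ≤ w) :
    ∃ ρ : X → ℕ, (∀ x, ρ x ≤ 2 * w + 1) ∧ (∀ x y, step x y → ρ y ≤ ρ x) ∧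
      (∀ x, bad x → Even (ρ x)) ∧
      ∀ f : ℕ → X, (∀ n, step (f n) (f (n + 1))) → ∃ n, Odd (ρ (f n)) := by
  have hex : ∀ x, ∃ i, rankStage step bad (i + 1) x := fun x =>
    ⟨w, rankStage_eq_univ hbad hsp hlev hfin hw x⟩
  let idx : X → ℕ := fun x => Nat.find (hex x)
  have hidx : ∀ x, rankStage step bad (idx x + 1) x := fun x => Nat.find_spec (hex x)
  have hidx_le : ∀ x i, rankStage step bad (i + 1) x → idx x ≤ i := fun x i h =>
    Nat.find_min' (hex x) h
  let ρ : X → ℕ := fun x =>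
    if Inevitable step (rankStage step bad (idx x)) x then 2 * idx x else 2 * idx x + 1
  have hρ_le : ∀ x, ρ x ≤ 2 * idx x + 1 := fun x => by
    simp only [ρ]
    split_ifs <;> omega
  have hρ_ge : ∀ x, 2 * idx x ≤ ρ x := fun x => by
    simp only [ρ]
    split_ifs <;> omega
  have hρ_even : ∀ x, Inevitable step (rankStage step bad (idx x)) x → ρ x = 2 * idx x :=
    fun x hx => if_pos hx
  have hρ_odd : ∀ x, ¬ Inevitable step (rankStage step bad (idx x)) x →
    ρ x = 2 * idx x + 1 := fun x hx => if_neg hx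
  have hρ_step : ∀ x y, step x y → ρ y ≤ ρ x := by
    intro x y hxy
    have hle : idx y ≤ idx x := hidx_le y _ (rankStage_of_step (hidx x) hxy)
    rcases hle.lt_or_eq with hlt | heq
    · have := hρ_le y
      have := hρ_ge x
      omega
    · by_cases hx : Inevitable step (rankStage step bad (idx x)) x
      · have hy := hx.of_step (fun _ _ => rankStage_of_step) hxy
        rw [hρ_even x hx, hρ_even y (heq ▸ hy), heq]
      · rw [hρ_odd x hx]
        have := hρ_le y
        omega
  refine ⟨ρ, fun x => ?_, hρ_step, fun x hx => ?_, fun f hf => ?_⟩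
  · have := hidx_le x w (rankStage_eq_univ hbad hsp hlev hfin hw x)
    have := hρ_le x
    omega
  · rw [hρ_even x (hidx x x ReflTransGen.refl hx)]
    exact even_two_mul _
  · by_contra hcon
    push Not at hcon
    obtain ⟨n₁, -, hn₁⟩ := eventually_const_of_antitone (fun n => ρ (f n)) 0
      fun n _ => hρ_step _ _ (hf n)
    have hinev : Inevitable step (rankStage step bad (idx (f n₁))) (f n₁) := by
      by_contra hI
      exact hcon n₁ (hρ_odd _ hI ▸ odd_two_mul_add_one _)
    obtain ⟨m, hm⟩ := hinev (fun n => f (n₁ + n)) rfl fun n => hf (n₁ + n)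
    have hconst := hn₁ (n₁ + m) (by omega)
    have heq := hρ_even _ hinev
    cases hi : idx (f n₁) with
    | zero =>
      rw [hi] at hm
      exact hm
    | succ i =>
      rw [hi] at hm heq
      have := hidx_le _ _ hm
      have := hρ_le (f (n₁ + m))
      omega

end Paths

/-! ### Latest appearance records -/

section Records

variable {Q : Type*}

open Classical in
/-- Move the elements of `Z` to the end of the list, keeping the order otherwise. -/
noncomputable def moveToEnd (Z : Q → Prop) (τ : List Q) : List Q :=
  τ.filter (fun q => ¬ Z q) ++ τ.filter (fun q => Z q)

open Classical in
/-- The part of a list before the first occurrence of `q`. -/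
noncomputable def before (q : Q) (τ : List Q) : List Q :=
  τ.takeWhile fun q' => q' ≠ q

theorem moveToEnd_perm (Z : Q → Prop) (τ : List Q) : (moveToEnd Z τ).Perm τ := by
  classical
  have h := List.filter_append_perm (fun q => decide (¬ Z q)) τ
  simpa [moveToEnd] using h

theorem exists_eq_before_append {q : Q} {τ : List Q} (h : q ∈ τ) :
    ∃ r, τ = before q τ ++ q :: r := by
  induction τ with
  | nil => simp at h
  | cons a t ih =>
    by_cases ha : a = q
    · exact ⟨t, by simp [before, ha]⟩
    · obtain ⟨r, hr⟩ := ih ((List.mem_cons.1 h).resolve_left (Ne.symm ha))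
      refine ⟨r, ?_⟩
      have : before q (a :: t) = a :: before q t := by simp [before, ha]
      rw [this, List.cons_append, ← hr]

open Classical in
theorem before_moveToEnd {Z : Q → Prop} {q : Q} {τ : List Q} (h : q ∈ τ) (hq : ¬ Z q) :
    before q (moveToEnd Z τ) = (before q τ).filter fun q => ¬ Z q := by
  have key : ∀ s : List Q, before q (τ.filter (fun q => ¬ Z q) ++ s) =
      (before q τ).filter fun q => ¬ Z q := by
    intro s
    induction τ with
    | nil => simp at h
    | cons a t ih =>
      by_cases ha : a = q
      · simp [before, ha, hq]
      · have ih' := ih ((List.mem_cons.1 h).resolve_left (Ne.symm ha))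
        have h1 : before q (a :: t) = a :: before q t := by simp [before, ha]
        by_cases hZ : Z a
        · simpa [h1, hZ] using ih'
        · have h2 : ∀ l, before q (a :: l) = a :: before q l := fun l => by simp [before, ha]
          simpa [h2, hZ] using ih'
  exact key _

theorem before_length_le (q : Q) (τ : List Q) : (before q τ).length ≤ τ.length :=
  (List.takeWhile_sublist _).length_le

variable {X α : Type*} [LinearOrder α]

/-- Lexicographic comparison of the values of two nodes, the head of the list being the most
significant quantity. -/
def LexLE (val : Q → X → α) : List Q → X → X → Prop
  | [], _, _ => True
  | q :: τ, x, y => val q x < val q y ∨ (val q x = val q y ∧ LexLE val τ x y)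

theorem exists_lexLE_min [WellFoundedLT α] (val : Q → X → α) (τ : List Q) (s : Set X)
    (hs : s.Nonempty) : ∃ x ∈ s, ∀ y ∈ s, LexLE val τ x y := by
  induction τ generalizing s with
  | nil =>
    obtain ⟨x, hx⟩ := hs
    exact ⟨x, hx, fun _ _ => trivial⟩
  | cons q τ ih =>
    obtain ⟨_, ⟨x, hx, rfl⟩, hmin⟩ := (wellFounded_lt (α := α)).has_min (val q '' s)
      (hs.image _)
    obtain ⟨z, ⟨hz, hzx⟩, hzmin⟩ := ih {y | y ∈ s ∧ val q y = val q x} ⟨x, hx, rfl⟩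
    refine ⟨z, hz, fun y hy => ?_⟩
    rcases (not_lt.1 (hmin _ ⟨y, hy, rfl⟩)).lt_or_eq with h | h
    · exact Or.inl (hzx ▸ h)
    · exact Or.inr ⟨hzx.trans h, hzmin y ⟨hy, h.symm⟩⟩

/-- The nodes `x n`, their successors `y n` and the orders `τ n` arising from a play in which at
each round the resetted quantities move to the end of the order and a lexicographically no worse
node replaces the successor. -/
structure RecordRun (val : Q → X → α) (reset : ℕ → Q → Prop) (x y : ℕ → X)
    (τ : ℕ → List Q) : Prop where
  nodup : ∀ n, (τ n).Nodup
  mem : ∀ n q, q ∈ τ n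
  order_succ : ∀ n, τ (n + 1) = moveToEnd (reset n) (τ n)
  lexLE : ∀ n, LexLE val (τ (n + 1)) (x (n + 1)) (y n)
  val_le : ∀ n q, ¬ reset n q → val q (y n) ≤ val q (x n)

variable {val : Q → X → α} {reset : ℕ → Q → Prop} {x y : ℕ → X} {τ : ℕ → List Q}

theorem before_succ_eq_or_length_lt (h : RecordRun val reset x y τ) {n : ℕ} {q : Q}
    (hq : ¬ reset n q) :
    (before q (τ (n + 1)) = before q (τ n) ∧ ∀ q' ∈ before q (τ n), ¬ reset n q') ∨
      (before q (τ (n + 1))).length < (before q (τ n)).length := by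
  classical
  rw [h.order_succ, before_moveToEnd (h.mem n q) hq]
  by_cases hall : ∀ q' ∈ before q (τ n), ¬ reset n q'
  · left
    refine ⟨?_, hall⟩
    rw [List.filter_eq_self]
    simpa using hall
  · right
    push Not at hall
    obtain ⟨q', hq', hr⟩ := hall
    exact List.length_filter_lt_length_iff_exists.2 ⟨q', hq', by simpa using hr⟩

theorem eventually_const_of_lexLE [WellFoundedLT α] (T : List Q) (n₀ : ℕ)
    (hlex : ∀ n, n₀ ≤ n → LexLE val T (x (n + 1)) (y n))
    (hle : ∀ n, n₀ ≤ n → ∀ q ∈ T, val q (y n) ≤ val q (x n)) :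
    ∃ n₁, n₀ ≤ n₁ ∧ ∀ n, n₁ ≤ n → ∀ q ∈ T,
      val q (y n) = val q (x n) ∧ val q (x (n + 1)) = val q (x n) := by
  induction T generalizing n₀ with
  | nil => exact ⟨n₀, le_rfl, by simp⟩
  | cons q T ih =>
    have h1 : ∀ n, n₀ ≤ n → val q (x (n + 1)) ≤ val q (y n) := fun n hn =>
      (hlex n hn).elim le_of_lt fun h => h.1.le
    have h2 : ∀ n, n₀ ≤ n → val q (y n) ≤ val q (x n) := fun n hn =>
      hle n hn q List.mem_cons_self
    obtain ⟨n₁, hn₁, hc⟩ := eventually_const_of_antitone (fun n => val q (x n)) n₀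
      fun n hn => (h1 n hn).trans (h2 n hn)
    have heq : ∀ n, n₁ ≤ n → val q (y n) = val q (x n) ∧ val q (x (n + 1)) = val q (x n) := by
      intro n hn
      have e : val q (x (n + 1)) = val q (x n) := (hc _ (by omega)).trans (hc n hn).symm
      exact ⟨le_antisymm (h2 n (hn₁.trans hn)) (e ▸ h1 n (hn₁.trans hn)), e⟩
    obtain ⟨n₂, hn₂, hT⟩ := ih n₁
      (fun n hn => (hlex n (hn₁.trans hn)).elim
        (fun h => absurd h (by rw [(heq n hn).1, (heq n hn).2]; exact lt_irrefl _)) fun h => h.2)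
      fun n hn q' hq' => hle n (hn₁.trans hn) q' (List.mem_cons_of_mem _ hq')
    refine ⟨n₂, hn₁.trans hn₂, fun n hn q' hq' => ?_⟩
    rcases List.mem_cons.1 hq' with rfl | hq'
    · exact heq n (hn₂.trans hn)
    · exact hT n hn q' hq'

theorem LexLE.of_append {T r : List Q} {a b : X} (h : LexLE val (T ++ r) a b) :
    LexLE val T a b := by
  induction T with
  | nil => trivial
  | cons q T ih => exact h.imp id fun h => ⟨h.1, ih h.2⟩

/-- A quantity that is reset only finitely often is eventually constant. -/
theorem RecordRun.eventually_const [WellFoundedLT α] (h : RecordRun val reset x y τ) (q : Q)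
    (n₀ : ℕ) (hq : ∀ n, n₀ ≤ n → ¬ reset n q) :
    ∃ n₁, n₀ ≤ n₁ ∧ ∀ n, n₁ ≤ n →
      val q (y n) = val q (x n) ∧ val q (x (n + 1)) = val q (x n) := by
  obtain ⟨n₁, hn₁, hlen⟩ := eventually_const_of_antitone (fun n => (before q (τ n)).length) n₀
    fun n hn => (before_succ_eq_or_length_lt h (hq n hn)).elim
      (fun h => (congrArg List.length h.1).le) le_of_lt
  have hsucc : ∀ n, n₁ ≤ n → before q (τ (n + 1)) = before q (τ n) ∧
      ∀ q' ∈ before q (τ n), ¬ reset n q' := by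
    intro n hn
    refine (before_succ_eq_or_length_lt h (hq n (hn₁.trans hn))).resolve_right ?_
    have h1 := hlen n hn
    have h2 := hlen (n + 1) (by omega)
    omega
  have hbefore : ∀ n, n₁ ≤ n → before q (τ n) = before q (τ n₁) := by
    intro n hn
    induction n, hn using Nat.le_induction with
    | base => rfl
    | succ n hn ih => rw [(hsucc n hn).1, ih]
  obtain ⟨n₂, hn₂, hc⟩ := eventually_const_of_lexLE (val := val) (x := x) (y := y)
    (before q (τ n₁) ++ [q]) n₁
    (fun n hn => by
      obtain ⟨r, hr⟩ := exists_eq_before_append (h.mem (n + 1) q)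
      have hl := h.lexLE n
      rw [hr, hbefore (n + 1) (by omega), List.append_cons] at hl
      exact hl.of_append)
    (fun n hn q' hq' => by
      refine h.val_le n q' ?_
      rcases List.mem_append.1 hq' with hq' | hq'
      · exact (hsucc n hn).2 q' (hbefore n hn ▸ hq')
      · obtain rfl := List.mem_singleton.1 hq'
        exact hq n (hn₁.trans hn))
  exact ⟨n₂, hn₁.trans hn₂, fun n hn => hc n hn q (by simp)⟩

/-- Number in base `b + 1` whose digits are the values of a node. -/
def encodeVal (val : Q → X → ℕ) (b : ℕ) : List Q → X → ℕ
  | [], _ => 0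
  | q :: τ, x => val q x * (b + 1) ^ τ.length + encodeVal val b τ x

section Bounded

variable {val : Q → X → ℕ} {b : ℕ}

theorem encodeVal_lt (hb : ∀ q x, val q x ≤ b) (τ : List Q) (x : X) :
    encodeVal val b τ x < (b + 1) ^ τ.length := by
  induction τ with
  | nil => simp [encodeVal]
  | cons q τ ih =>
    rw [encodeVal, List.length_cons, pow_succ]
    have := Nat.mul_le_mul_right ((b + 1) ^ τ.length) (hb q x)
    nlinarith

theorem encodeVal_mono {τ : List Q} {a c : X} (h : ∀ q ∈ τ, val q a ≤ val q c) :
    encodeVal val b τ a ≤ encodeVal val b τ c := by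
  induction τ with
  | nil => exact le_rfl
  | cons q τ ih =>
    exact Nat.add_le_add (Nat.mul_le_mul_right _ (h q List.mem_cons_self))
      (ih fun q' hq' => h q' (List.mem_cons_of_mem _ hq'))

theorem LexLE.encodeVal_lt_or (hb : ∀ q x, val q x ≤ b) {T r : List Q} {q : Q} {a c : X}
    (h : LexLE val (T ++ q :: r) a c) : encodeVal val b T a < encodeVal val b T c ∨
      (encodeVal val b T a = encodeVal val b T c ∧ val q a ≤ val q c) := by
  induction T with
  | nil => exact Or.inr ⟨rfl, h.elim le_of_lt fun h => h.1.le⟩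
  | cons q' T ih =>
    rcases h with h | ⟨h, h'⟩
    · left
      rw [encodeVal, encodeVal]
      have h1 := Nat.mul_le_mul_right ((b + 1) ^ T.length) (Nat.succ_le_of_lt h)
      have h2 := encodeVal_lt hb T a
      rw [Nat.succ_mul] at h1
      omega
    · rcases ih h' with h1 | h1
      · left
        rw [encodeVal, encodeVal, h]
        omega
      · right
        rw [encodeVal, encodeVal, h]
        exact ⟨by omega, h1.2⟩

/-- Potential that decreases whenever the quantity `q` gets worse without being reset. -/
noncomputable def potential (val : Q → X → ℕ) (b m : ℕ) (q : Q) (τ : List Q) (x : X) : ℕ :=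
  (before q τ).length * (b + 1) ^ m + encodeVal val b (before q τ) x

theorem potential_le (hb : ∀ q x, val q x ≤ b) {m : ℕ} {q : Q} {τ : List Q} (hm : τ.length ≤ m)
    (x : X) : potential val b m q τ x ≤ (m + 1) * (b + 1) ^ m := by
  have hl := (before_length_le q τ).trans hm
  have h1 := encodeVal_lt hb (before q τ) x
  have h2 : (b + 1) ^ (before q τ).length ≤ (b + 1) ^ m := Nat.pow_le_pow_right (by omega) hl
  have h3 := Nat.mul_le_mul_right ((b + 1) ^ m) hl
  rw [potential, Nat.succ_mul]
  omega

theorem RecordRun.potential_succ (h : RecordRun val reset x y τ) (hb : ∀ q x, val q x ≤ b)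
    {m n : ℕ} {q : Q} (hm : ∀ n, (τ n).length ≤ m) (hq : ¬ reset n q) :
    potential val b m q (τ (n + 1)) (x (n + 1)) < potential val b m q (τ n) (x n) ∨
      (potential val b m q (τ (n + 1)) (x (n + 1)) ≤ potential val b m q (τ n) (x n) ∧
        val q (x (n + 1)) ≤ val q (y n)) := by
  rcases before_succ_eq_or_length_lt h hq with ⟨heq, hr⟩ | hlt
  · obtain ⟨r, hr'⟩ := exists_eq_before_append (h.mem (n + 1) q)
    have hl := h.lexLE n
    rw [hr', heq] at hl
    have hmono : encodeVal val b (before q (τ n)) (y n) ≤ encodeVal val b (before q (τ n)) (x n) :=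
      encodeVal_mono fun q' hq' => h.val_le n q' (hr q' hq')
    rw [potential, potential, heq]
    rcases hl.encodeVal_lt_or hb with h1 | h1
    · left
      omega
    · right
      exact ⟨by omega, h1.2⟩
  · left
    have h1 := encodeVal_lt hb (before q (τ (n + 1))) (x (n + 1))
    have h2 : (b + 1) ^ (before q (τ (n + 1))).length ≤ (b + 1) ^ m :=
      Nat.pow_le_pow_right (by omega) ((before_length_le _ _).trans (hm _))
    have h3 := Nat.mul_le_mul_right ((b + 1) ^ m) (Nat.succ_le_of_lt hlt)
    rw [Nat.succ_mul] at h3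
    rw [potential, potential]
    omega

end Bounded

end Records

/-! ### Strategies from graphs covering an arena -/

section Covers

variable {V E : Type} {k : ℕ}

/-- A graph whose nodes project to vertices of the arena and that follows at least one choice of
Eve and every choice of Adam. Nodes carry a label `bit`. -/
structure Cover (A : Arena V E k) (X P : Type) where
  pr : X → V
  bit : X → P
  edge : X → E → X → Prop
  src_eq : ∀ x e y, edge x e y → A.src e = pr x
  tgt_eq : ∀ x e y, edge x e y → A.tgt e = pr y
  exists_of_eve : ∀ x, A.eve (pr x) → ∃ e y, edge x e y
  exists_of_not_eve : ∀ x e, ¬ A.eve (pr x) → A.src e = pr x → ∃ y, edge x e y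

variable {A : Arena V E k} {X P Q : Type} {α : Type*} [LinearOrder α] [WellFoundedLT α]

/-- Eve can follow a cover by remembering only the label of the current node and an order on the
quantities. -/
theorem Cover.exists_strategy [Fintype Q] (C : Cover A X P) (hE : ∀ v, ∃ e, A.src e = v) (x₀ : X)
    (reset : E → Q → Prop) (val : Q → X → α)
    (hval : ∀ x e y q, C.edge x e y → ¬ reset e q → val q y ≤ val q x) :
    ∃ S : Strategy V E (P × {τ : List Q // τ.Nodup}), S.Valid A ∧
      ∀ π : ℕ → E, A.src (π 0) = C.pr x₀ → A.IsPath π → S.Consistent A π →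
        ∃ (x y : ℕ → X) (τ : ℕ → List Q), RecordRun val (fun n => reset (π n)) x y τ ∧
          C.bit (x 0) = C.bit x₀ ∧ (∀ n, C.pr (x n) = A.src (π n)) ∧
          (∀ n, C.edge (x n) (π n) (y n)) ∧ ∀ n, C.bit (x (n + 1)) = C.bit (y n) := by
  classical
  have hpick : ∀ v b (τ : List Q), ∃ x, (∃ x', C.pr x' = v ∧ C.bit x' = b) →
      (C.pr x = v ∧ C.bit x = b) ∧ ∀ x', C.pr x' = v ∧ C.bit x' = b → LexLE val τ x x' := by
    intro v b τ
    by_cases h : ∃ x', C.pr x' = v ∧ C.bit x' = b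
    · obtain ⟨x, hx, hmin⟩ := exists_lexLE_min val τ {x | C.pr x = v ∧ C.bit x = b} h
      exact ⟨x, fun _ => ⟨hx, hmin⟩⟩
    · exact ⟨x₀, fun h' => absurd h' h⟩
  choose pick hpick using hpick
  have hnxt : ∀ x e, ∃ y, (∃ y', C.edge x e y') → C.edge x e y := by
    intro x e
    by_cases h : ∃ y', C.edge x e y'
    · exact h.imp fun y hy _ => hy
    · exact ⟨x₀, fun h' => absurd h' h⟩
  choose nxt hnxt using hnxt
  have hmv : ∀ v b τ, ∃ e, A.src e = v ∧
      (A.eve v → C.pr (pick v b τ) = v → ∃ y, C.edge (pick v b τ) e y) := by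
    intro v b τ
    by_cases h : A.eve v ∧ C.pr (pick v b τ) = v
    · obtain ⟨e, y, hy⟩ := C.exists_of_eve (pick v b τ) (h.2.symm ▸ h.1)
      exact ⟨e, (C.src_eq _ _ _ hy).trans h.2, fun _ _ => ⟨y, hy⟩⟩
    · obtain ⟨e, he⟩ := hE v
      exact ⟨e, he, fun h1 h2 => absurd ⟨h1, h2⟩ h⟩
  choose mv hmv using hmv
  let S : Strategy V E (P × {τ : List Q // τ.Nodup}) :=
    { init := (C.bit x₀, ⟨Finset.univ.toList, Finset.nodup_toList _⟩)
      update := fun m e => (C.bit (nxt (pick (A.src e) m.1 m.2.1) e),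
        ⟨moveToEnd (reset e) m.2.1, (moveToEnd_perm _ _).nodup_iff.2 m.2.2⟩)
      move := fun v m => mv v m.1 m.2.1 }
  refine ⟨S, fun v m _ _ => (hmv v m.1 m.2.1).1, fun π hπ0 hpath hcons => ?_⟩
  let mem : ℕ → P × {τ : List Q // τ.Nodup} := S.memAt π
  let x : ℕ → X := fun n => pick (A.src (π n)) (mem n).1 (mem n).2.1
  let y : ℕ → X := fun n => nxt (x n) (π n)
  have hmem : ∀ n, mem (n + 1) = (C.bit (y n),
      ⟨moveToEnd (reset (π n)) (mem n).2.1, (moveToEnd_perm _ _).nodup_iff.2 (mem n).2.2⟩) :=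
    fun _ => rfl
  have hedge : ∀ n, (C.pr (x n) = A.src (π n) ∧ C.bit (x n) = (mem n).1) →
      C.edge (x n) (π n) (y n) := by
    intro n hn
    apply hnxt
    by_cases hv : A.eve (A.src (π n))
    · have := (hmv (A.src (π n)) (mem n).1 (mem n).2.1).2 hv hn.1
      rw [hcons n hv]
      exact this
    · exact C.exists_of_not_eve _ _ (hn.1.symm ▸ hv) hn.1.symm
  have hx : ∀ n, C.pr (x n) = A.src (π n) ∧ C.bit (x n) = (mem n).1 := by
    intro n
    induction n with
    | zero => exact (hpick _ _ _ ⟨x₀, hπ0.symm, rfl⟩).1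
    | succ n ih =>
      refine (hpick _ _ _ ⟨y n, ?_, ?_⟩).1
      · rw [← C.tgt_eq _ _ _ (hedge n ih), hpath n]
      · rw [hmem]
  refine ⟨x, y, fun n => (mem n).2.1, ?_, ?_, fun n => (hx n).1, fun n => hedge n (hx n), ?_⟩
  · refine ⟨fun n => (mem n).2.2, fun n => ?_, fun n => by rw [hmem], fun n => ?_,
      fun n q hq => hval _ _ _ _ (hedge n (hx n)) hq⟩
    · induction n with
      | zero => exact fun q => Finset.mem_toList.2 (Finset.mem_univ q)
      | succ n ih =>
        intro q
        rw [hmem]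
        exact (moveToEnd_perm _ _).mem_iff.2 (ih q)
    · refine (hpick (A.src (π (n + 1))) (mem (n + 1)).1 (mem (n + 1)).2.1 ?_).2 (y n) ?_
      · exact ⟨x (n + 1), hx (n + 1)⟩
      · exact ⟨by rw [← C.tgt_eq _ _ _ (hedge n (hx n)), hpath n], by rw [hmem]⟩
  · rw [(hx 0).2]
    rfl
  · intro n
    rw [(hx (n + 1)).2, hmem]

/-! ### The parity condition -/

/-- The largest number occurring infinitely often in the sequence exists and is even. -/
def ParitySeq (s : ℕ → ℕ) : Prop :=
  ∃ c, Even c ∧ InfOften (fun n => s n = c) ∧ ∀ c', c < c' → ¬ InfOften fun n => s n = c'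

theorem infOften_succ {p : ℕ → Prop} : InfOften (fun n => p (n + 1)) ↔ InfOften p := by
  constructor
  · intro h n
    obtain ⟨m, hm, hp⟩ := h n
    exact ⟨m + 1, by omega, hp⟩
  · intro h n
    obtain ⟨m, hm, hp⟩ := h (n + 1)
    obtain ⟨m, rfl⟩ : ∃ m', m = m' + 1 := ⟨m - 1, by omega⟩
    exact ⟨m, by omega, hp⟩

theorem ParitySeq.tail {s : ℕ → ℕ} (h : ParitySeq s) : ParitySeq fun n => s (n + 1) := by
  obtain ⟨c, hc, hi, hmax⟩ := h
  exact ⟨c, hc, (infOften_succ (p := fun n => s n = c)).2 hi, fun c' hc' hi' =>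
    hmax c' hc' ((infOften_succ (p := fun n => s n = c')).1 hi')⟩

theorem ParitySeq.eventually_ne {s : ℕ → ℕ} (h : ParitySeq s) {p : ℕ} (hp : Odd p)
    (hle : ∀ n, s n ≤ p) : ∃ n, ∀ m, n ≤ m → s m ≠ p := by
  by_contra hcon
  push Not at hcon
  obtain ⟨c, hc, hi, hmax⟩ := h
  rcases lt_trichotomy c p with h1 | rfl | h1
  · exact hmax p h1 fun n => hcon n
  · exact (Nat.not_even_iff_odd.2 hp) hc
  · obtain ⟨m, -, hm⟩ := hi 0
    have := hle m
    omega

theorem paritySeq_of_odd_contradiction {s : ℕ → ℕ} {d : ℕ} (hd : ∀ n, s n ≤ d)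
    (h : ∀ p, p ≤ d → Odd p → InfOften (fun n => s n = p) →
      ∀ n₀, (∀ n, n₀ ≤ n → s n ≤ p) → False) : ParitySeq s := by
  classical
  have hev : ∀ d', (∀ p, d' < p → ¬ InfOften fun n => s n = p) →
      ∃ n₀, ∀ n, n₀ ≤ n → s n ≤ d' := by
    intro d' hd'
    have hfin : ∀ p, ∃ n₀, d' < p → ∀ m, n₀ ≤ m → s m ≠ p := by
      intro p
      by_cases hp : d' < p
      · have := hd' p hp
        unfold InfOften at this
        push Not at this
        exact this.imp fun n hn _ => hn
      · exact ⟨0, fun h => absurd h hp⟩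
    choose g hg using hfin
    refine ⟨(Finset.range (d + 1)).sup g, fun n hn => ?_⟩
    by_contra hcon
    refine hg (s n) (not_le.1 hcon) n (le_trans ?_ hn) rfl
    exact Finset.le_sup (f := g) (Finset.mem_range.2 (by have := hd n; omega))
  have hne : ∃ p, p ≤ d ∧ InfOften fun n => s n = p := by
    by_contra hcon
    push Not at hcon
    obtain ⟨n₀, hn₀⟩ := hev 0 fun p _ hi => by
      refine hcon p ?_ hi
      obtain ⟨m, -, hm⟩ := hi 0
      exact hm ▸ hd m
    exact hcon 0 (Nat.zero_le _) fun n => ⟨max n n₀, le_max_left _ _,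
      Nat.le_zero.1 (hn₀ _ (le_max_right _ _))⟩
  obtain ⟨p₀, hp₀, hi₀⟩ := hne
  let p := Nat.findGreatest (fun p => InfOften fun n => s n = p) d
  have hp : InfOften fun n => s n = p :=
    Nat.findGreatest_spec (P := fun p => InfOften fun n => s n = p) hp₀ hi₀
  have hpd : p ≤ d := Nat.findGreatest_le d
  have hmax : ∀ c', p < c' → ¬ InfOften fun n => s n = c' := by
    intro c' hc' hi
    obtain ⟨m, -, hm⟩ := hi 0
    exact Nat.findGreatest_is_greatest (P := fun p => InfOften fun n => s n = p) hc'
      (hm ▸ hd m) hi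
  refine ⟨p, ?_, hp, hmax⟩
  by_contra hodd
  obtain ⟨n₀, hn₀⟩ := hev p hmax
  exact h p hpd (Nat.not_even_iff_odd.1 hodd) hp n₀ hn₀

/-! ### The graph of winning states of a strategy -/

variable {M : Type}

/-- One step of a play consistent with `S` on triples of a vertex, a memory state and counter
values. -/
def StateStep (A : Arena V E k) (S : Strategy V E M) (x : V × M × (Fin k → ℕ)) (e : E)
    (y : V × M × (Fin k → ℕ)) : Prop :=
  A.src e = x.1 ∧ (A.eve x.1 → e = S.move x.1 x.2.1) ∧
    y = (A.tgt e, S.update x.2.1 e, fun j => updC (x.2.2 j) (A.act e j))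

/-- All plays consistent with `S` from the given state have value at most `N` and satisfy the
parity condition. -/
def WinningState (A : Arena V E k) (Ω : V → ℕ) (S : Strategy V E M) (N : ℕ)
    (x : V × M × (Fin k → ℕ)) : Prop :=
  ∀ ξ : ℕ → V × M × (Fin k → ℕ), ξ 0 = x → (∀ n, ∃ e, StateStep A S (ξ n) e (ξ (n + 1))) →
    (∀ n j, (ξ n).2.2 j ≤ N) ∧ ParitySeq fun n => Ω (ξ n).1

variable {Ω : V → ℕ} {S : Strategy V E M} {N : ℕ}

theorem exists_stateStep (hS : S.Valid A) (hE : ∀ v, ∃ e, A.src e = v)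
    (x : V × M × (Fin k → ℕ)) : ∃ e y, StateStep A S x e y := by
  by_cases hv : A.eve x.1
  · exact ⟨S.move x.1 x.2.1, _, hS _ _ hv (hE _), fun _ => rfl, rfl⟩
  · obtain ⟨e, he⟩ := hE x.1
    exact ⟨e, _, he, fun h => absurd h hv, rfl⟩

theorem WinningState.counter_le (hS : S.Valid A) (hE : ∀ v, ∃ e, A.src e = v)
    {x : V × M × (Fin k → ℕ)} (hx : WinningState A Ω S N x) (j : Fin k) : x.2.2 j ≤ N := by
  obtain ⟨f, hf0, hf⟩ := exists_seq_of_forall_exists (fun x y => ∃ e, StateStep A S x e y)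
    (fun _ => True) (fun x _ => by
      obtain ⟨e, y, h⟩ := exists_stateStep hS hE x
      exact ⟨y, trivial, e, h⟩) x trivial
  have := (hx f hf0 fun n => (hf n).2).1 0 j
  rwa [hf0] at this

theorem WinningState.step {x y : V × M × (Fin k → ℕ)} (hx : WinningState A Ω S N x) {e : E}
    (h : StateStep A S x e y) : WinningState A Ω S N y := by
  intro ξ hξ0 hξ
  have h' := hx (fun n => Nat.casesOn n x ξ) rfl (by
    rintro (_ | n)
    · refine ⟨e, ?_⟩
      change StateStep A S x e (ξ 0)
      rw [hξ0]
      exact h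
    · exact hξ n)
  exact ⟨fun n => h'.1 (n + 1), h'.2.tail⟩

theorem winningState_init {v₀ : V}
    (h : Ensures A S v₀ fun π => A.BoundedBy π N ∧ ParityPlay A Ω π) :
    WinningState A Ω S N (v₀, S.init, fun _ => 0) := by
  intro ξ hξ0 hξ
  choose π hsrc hcons hnext using hξ
  have hmem : ∀ n, S.memAt π n = (ξ n).2.1 := by
    intro n
    induction n with
    | zero => rw [hξ0]; rfl
    | succ n ih => rw [hnext n, Strategy.memAt, ih]
  have hcval : ∀ n j, A.cval π j n = (ξ n).2.2 j := by
    intro n j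
    induction n with
    | zero => rw [hξ0]; rfl
    | succ n ih => rw [hnext n, Arena.cval, ih]
  obtain ⟨hb, hp⟩ := h π (by rw [hsrc, hξ0]) (fun n => by rw [hsrc, hnext])
    (fun n hn => by
      rw [hmem, hsrc]
      exact hcons n (hsrc n ▸ hn))
  refine ⟨fun n j => hcval n j ▸ hb j n, ?_⟩
  have : (fun n => Ω (ξ n).1) = fun n => Ω (A.src (π n)) := by
    funext n
    rw [hsrc]
  rw [this]
  exact hp

/-- The cover of the arena by the winning states of a strategy. -/
def winningCover (A : Arena V E k) (Ω : V → ℕ) (S : Strategy V E M) (N : ℕ) (hS : S.Valid A)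
    (hE : ∀ v, ∃ e, A.src e = v) :
    Cover A {x // WinningState A Ω S N x} (Fin k → Fin (N + 1)) where
  pr x := x.1.1
  bit x j := ⟨x.1.2.2 j, Nat.lt_succ_of_le (x.2.counter_le hS hE j)⟩
  edge x e y := StateStep A S x.1 e y.1
  src_eq _ _ _ h := h.1
  tgt_eq _ _ _ h := by rw [h.2.2]
  exists_of_eve x _ := by
    obtain ⟨e, y, h⟩ := exists_stateStep hS hE x.1
    exact ⟨e, ⟨y, x.2.step h⟩, h⟩
  exists_of_not_eve x e hx he := by
    have h : StateStep A S x.1 e _ := ⟨he, fun h => absurd h hx, rfl⟩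
    exact ⟨⟨_, x.2.step h⟩, h⟩

/-- In the graph of winning states, paths on which colours stay at most `p`, for odd `p`, see the
colour `p` finitely often. -/
theorem winningState_finitelyBad {p : ℕ} (hp : Odd p) :
    FinitelyBad (fun x y : {x // WinningState A Ω S N x} =>
      (∃ e, StateStep A S x.1 e y.1) ∧ Ω x.1.1 ≤ p) fun x => Ω x.1.1 = p :=
  fun f hf => ((f 0).2 (fun n => (f n).1) rfl fun n => (hf n).1).2.eventually_ne hp
    fun n => (hf n).2

open Classical in
/-- If Eve can ensure a bound and the parity condition, then she can do so with memory of size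
depending only on the bound, the number of counters and the number of colours. -/
theorem exists_finite_memory_strategy {d : ℕ} {v₀ : V} (hΩ : ∀ v, Ω v ≤ d) (hS : S.Valid A)
    (hE : ∀ v, ∃ e, A.src e = v)
    (h : Ensures A S v₀ fun π => A.BoundedBy π N ∧ ParityPlay A Ω π) :
    ∃ S' : Strategy V E ((Fin k → Fin (N + 1)) × {τ : List (Fin (d + 1)) // τ.Nodup}),
      S'.Valid A ∧ Ensures A S' v₀ fun π => A.BoundedBy π N ∧ ParityPlay A Ω π := by
  let X := {x // WinningState A Ω S N x}
  let C := winningCover A Ω S N hS hE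
  let step : ℕ → X → X → Prop := fun p x y => (∃ e, StateStep A S x.1 e y.1) ∧ Ω x.1.1 ≤ p
  have hrank : ∀ p, Odd p → ∃ ρ : X → Ordinal.{0}, ∀ x y, step p x y →
      ρ y ≤ ρ x ∧ (Ω x.1.1 = p → ρ y < ρ x) := by
    intro p hp
    have hwf := (winningState_finitelyBad (A := A) (Ω := Ω) (S := S) (N := N) hp).wellFounded
    have : IsWellFounded X fun y x => ReachesThrough (step p) (fun x => Ω x.1.1 = p) x y := ⟨hwf⟩
    let r := fun y x : X => ReachesThrough (step p) (fun x => Ω x.1.1 = p) x y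
    refine ⟨IsWellFounded.rank r, fun x y hxy => ⟨?_, fun hx => ?_⟩⟩
    · by_contra hcon
      have hlt := not_le.1 hcon
      rw [IsWellFounded.rank_eq r y] at hlt
      obtain ⟨⟨z, hz⟩, hlt⟩ := Ordinal.lt_iSup_iff.1 hlt
      rw [Order.lt_succ_iff] at hlt
      refine absurd (IsWellFounded.rank_lt_of_rel (r := r) (a := z) (b := x) ?_) (not_lt.2 hlt)
      obtain ⟨u, hu, hu'⟩ := hz
      exact ⟨u, ReflTransGen.head hxy hu, hu'⟩
    · exact IsWellFounded.rank_lt_of_rel (r := r) ⟨x, ReflTransGen.refl, hx, hxy⟩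
  choose! ρ hρ using hrank
  let val : Fin (d + 1) → X → Ordinal.{0} := fun p x => if Odd p.1 then ρ p.1 x else 0
  obtain ⟨S', hvalid, hrun⟩ := C.exists_strategy hE ⟨_, winningState_init h⟩
    (fun e (p : Fin (d + 1)) => p.1 < Ω (A.src e)) val (by
      intro x e y p hxy hr
      simp only [val]
      split_ifs with hp
      · refine (hρ p.1 hp x y ⟨⟨e, hxy⟩, ?_⟩).1
        rw [← hxy.1]
        exact not_lt.1 hr
      · exact le_rfl)
  refine ⟨S', hvalid, fun π hπ0 hpath hcons => ?_⟩
  obtain ⟨x, y, τ, hrec, hbit0, hpr, hedge, hbit⟩ := hrun π hπ0 hpath hcons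
  have hcounter : ∀ a b : X, C.bit a = C.bit b → a.1.2.2 = b.1.2.2 := fun a b hab => by
    funext j
    exact congrArg Fin.val (congrFun hab j)
  have hcval : ∀ n j, A.cval π j n = (x n).1.2.2 j := by
    intro n j
    induction n with
    | zero =>
      rw [hcounter _ _ hbit0]
      rfl
    | succ n ih => rw [hcounter _ _ (hbit n), (hedge n).2.2, Arena.cval, ih]
  refine ⟨fun j n => hcval n j ▸ (x n).2.counter_le hS hE j, ?_⟩
  refine paritySeq_of_odd_contradiction (d := d) (fun n => hΩ _) fun p hpd hp hi n₀ hn₀ => ?_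
  obtain ⟨n₁, hn₁, hc⟩ := hrec.eventually_const ⟨p, by omega⟩ n₀ fun n hn => not_lt.2 (hn₀ n hn)
  obtain ⟨n, hn, hpn⟩ := hi n₁
  have heq := (hc n hn).1
  simp only [val, if_pos hp] at heq
  have hxn : (x n).1.1 = A.src (π n) := hpr n
  exact ((hρ p hp (x n) (y n) ⟨⟨_, hedge n⟩, by rw [hxn, hpn]⟩).2 (by rw [hxn, hpn])).ne heq

end Covers

/-! ### Spines of thin trees -/

section Spines

theorem prefixOf_length (b : ℕ → Bool) (n : ℕ) : (prefixOf b n).length = n := by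
  simp [prefixOf]

theorem prefixOf_succ (b : ℕ → Bool) (n : ℕ) : prefixOf b (n + 1) = prefixOf b n ++ [b n] := by
  unfold prefixOf
  rw [List.ofFn_succ_last]
  simp

variable {V : Type} {R : V → List Bool}

/-- Every sequence of vertices descending in a tree runs along a branch. -/
theorem exists_branch (hpre : ∀ l ∈ Set.range R, ∀ l' : List Bool, l' <+: l → l' ∈ Set.range R)
    (w : ℕ → V) (hw : ∀ n, ∃ ℓ : Bool, R (w (n + 1)) = R (w n) ++ [ℓ]) :
    ∃ b : ℕ → Bool, (∀ n, prefixOf b n ∈ Set.range R) ∧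
      ∀ n, prefixOf b (R (w n)).length = R (w n) := by
  have hmono : ∀ n m, n ≤ m → R (w n) <+: R (w m) := by
    intro n m hnm
    induction m, hnm using Nat.le_induction with
    | base => exact List.prefix_rfl
    | succ m _ ih =>
      obtain ⟨ℓ, hℓ⟩ := hw m
      exact ih.trans (hℓ ▸ List.prefix_append _ _)
  have hlen : ∀ n, n ≤ (R (w n)).length := by
    intro n
    induction n with
    | zero => exact Nat.zero_le _
    | succ n ih =>
      obtain ⟨ℓ, hℓ⟩ := hw n
      rw [hℓ, List.length_append]
      simpa using ih
  let b : ℕ → Bool := fun i => (R (w (i + 1))).getD i false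
  have hb : ∀ n i, (h : i < (R (w n)).length) → b i = (R (w n))[i] := by
    intro n i h
    have hi : i < (R (w (i + 1))).length := hlen (i + 1)
    have e : b i = (R (w (i + 1)))[i] := by simp [b, hi]
    rw [e]
    rcases le_total n (i + 1) with hle | hle
    · exact ((hmono _ _ hle).getElem h).symm
    · exact (hmono _ _ hle).getElem hi
  have htake : ∀ n m, m ≤ (R (w n)).length → prefixOf b m = (R (w n)).take m := by
    intro n m hm
    refine List.ext_getElem ?_ fun i h1 h2 => ?_
    · rw [prefixOf_length, List.length_take, min_eq_left hm]
    · rw [prefixOf_length] at h1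
      rw [List.getElem_take, ← hb n i (by omega)]
      simp [prefixOf]
  refine ⟨b, fun n => hpre _ ⟨w n, rfl⟩ _ ?_, fun n => ?_⟩
  · rw [htake n n (hlen n)]
    exact List.take_prefix _ _
  · rw [htake n _ le_rfl, List.take_length]

/-- The nodes of a thin tree can be partitioned into spines such that a spine has at most one
node on every level and every branch eventually stays in one spine. -/
theorem exists_spine (hpre : ∀ l ∈ Set.range R, ∀ l' : List Bool, l' <+: l → l' ∈ Set.range R)
    (hthin : ({b : ℕ → Bool | ∀ n, prefixOf b n ∈ Set.range R}).Countable)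
    (hsucc : ∀ v, ∃ v', ∃ ℓ : Bool, R v' = R v ++ [ℓ]) :
    ∃ sp : V → ℕ, (∀ v v', sp v = sp v' → (R v).length = (R v').length → R v = R v') ∧
      ∀ w : ℕ → V, (∀ n, ∃ ℓ : Bool, R (w (n + 1)) = R (w n) ++ [ℓ]) →
        ∃ n₀, ∀ n, n₀ ≤ n → sp (w n) = sp (w n₀) := by
  obtain ⟨f, hf⟩ := Set.countable_iff_exists_injOn.1 hthin
  let through : V → Set (ℕ → Bool) := fun v =>
    {b | (∀ n, prefixOf b n ∈ Set.range R) ∧ prefixOf b (R v).length = R v}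
  have hne : ∀ v, (f '' through v).Nonempty := by
    intro v
    obtain ⟨w, hw0, hw⟩ := exists_seq_of_forall_exists
      (fun v v' => ∃ ℓ : Bool, R v' = R v ++ [ℓ]) (fun _ => True)
      (fun v _ => (hsucc v).imp fun _ h => ⟨trivial, h⟩) v trivial
    obtain ⟨b, hb, hbw⟩ := exists_branch hpre w fun n => (hw n).2
    exact ⟨f b, b, ⟨hb, hw0 ▸ hbw 0⟩, rfl⟩
  refine ⟨fun v => sInf (f '' through v), fun v v' hvv' hlen => ?_, fun w hw => ?_⟩
  · obtain ⟨b, hb, hbf⟩ := Nat.sInf_mem (hne v)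
    obtain ⟨b', hb', hbf'⟩ := Nat.sInf_mem (hne v')
    have : b = b' := hf hb.1 hb'.1 (hbf.trans (hvv'.trans hbf'.symm))
    rw [← hb.2, ← hb'.2, this, hlen]
  · obtain ⟨b, hb, hbw⟩ := exists_branch hpre w hw
    have hle : ∀ n, sInf (f '' through (w n)) ≤ f b := fun n => Nat.sInf_le ⟨b, ⟨hb, hbw n⟩, rfl⟩
    have hmono : ∀ n, sInf (f '' through (w n)) ≤ sInf (f '' through (w (n + 1))) := by
      intro n
      obtain ⟨b', hb', hbf'⟩ := Nat.sInf_mem (hne (w (n + 1)))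
      rw [← hbf']
      refine Nat.sInf_le ⟨b', ⟨hb'.1, ?_⟩, rfl⟩
      obtain ⟨ℓ, hℓ⟩ := hw n
      have h := hb'.2
      rw [hℓ, List.length_append, List.length_singleton, prefixOf_succ] at h
      exact (List.append_inj h (prefixOf_length _ _)).1
    obtain ⟨n₀, -, hn₀⟩ := eventually_const_of_antitone
      (fun n => f b - sInf (f '' through (w n))) 0 fun n _ => Nat.sub_le_sub_left (hmono n) _
    refine ⟨n₀, fun n hn => ?_⟩
    have h1 := hn₀ n hn
    have h2 := hle n
    have h3 := hle n₀
    beta_reduce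
    omega

end Spines

/-! ### Strategies with small memory -/

section SmallMemory

/-- Time left at level `l` until the current deadline; when a deadline is over, the next one is
`T` levels away. -/
def timeLeft (T : ℕ → ℕ) : ℕ → ℕ
  | 0 => T 0
  | l + 1 => if timeLeft T l = 0 then T (l + 1) else timeLeft T l - 1

theorem exists_timeLeft_eq_zero (T : ℕ → ℕ) (l : ℕ) : ∃ i, timeLeft T (l + i) = 0 := by
  by_contra hcon
  push Not at hcon
  have h : ∀ i, timeLeft T (l + i) + i ≤ timeLeft T l := by
    intro i
    induction i with
    | zero => exact le_rfl
    | succ i ih =>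
      have h0 := hcon i
      have : timeLeft T (l + i + 1) = timeLeft T (l + i) - 1 := if_neg h0
      have hl : l + (i + 1) = l + i + 1 := rfl
      rw [hl, this]
      omega
  have := h (timeLeft T l + 1)
  omega

/-- The factor by which counter values may grow for `m` quantities bounded by `b`. -/
def growth (m b : ℕ) : ℕ := (m + 1) * (b + 1) ^ m

variable {V E M : Type} {k : ℕ} {A : Arena V E k} {Ω : V → ℕ} {S : Strategy V E M} {N d w : ℕ}

theorem le_updC {c : ℕ} {a : CAct} (h : a ≠ CAct.reset) : c ≤ updC c a := by
  cases a <;> simp_all [updC]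

open Classical in
/-- On an arena partitioned into spines of bounded width, memory depending only on the number of
counters and colours suffices, at the price of a larger bound. -/
theorem exists_small_memory_strategy {v₀ : V} (hΩ : ∀ v, Ω v ≤ d) (hS : S.Valid A)
    (hE : ∀ v, ∃ e, A.src e = v)
    (h : Ensures A S v₀ fun π => A.BoundedBy π N ∧ ParityPlay A Ω π)
    (sp lev : V → ℕ) (hlev : ∀ e, lev (A.tgt e) = lev (A.src e) + 1)
    (hsp : ∀ π : ℕ → E, A.IsPath π →
      ∃ n₀, ∀ n, n₀ ≤ n → sp (A.src (π n)) = sp (A.src (π n₀)))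
    (hfin : ∀ s l, {x : {x // WinningState A Ω S N x} | sp x.1.1 = s ∧ lev x.1.1 = l}.Finite)
    (hw : ∀ s l, {x : {x // WinningState A Ω S N x} | sp x.1.1 = s ∧ lev x.1.1 = l}.ncard ≤ w) :
    ∃ S' : Strategy V E (Finset (Fin (d + 1)) × {τ : List (Fin k ⊕ Fin (d + 1)) // τ.Nodup}),
      S'.Valid A ∧ Ensures A S' v₀ fun π =>
        A.BoundedBy π (N * (1 + growth (k + (d + 1)) (N + (2 * w + 1)))) ∧ ParityPlay A Ω π := by
  let X := {x // WinningState A Ω S N x}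
  let step : ℕ → X → X → Prop := fun p x y =>
    (∃ e, StateStep A S x.1 e y.1) ∧ Ω x.1.1 ≤ p ∧ sp y.1.1 = sp x.1.1
  have hstep_lev : ∀ {x y : X} {e : E}, StateStep A S x.1 e y.1 →
      lev y.1.1 = lev x.1.1 + 1 := by
    intro x y e hxy
    rw [hxy.2.2, ← hxy.1]
    exact hlev e
  have hrank : ∀ p, Odd p → ∃ ρ : X → ℕ, (∀ x, ρ x ≤ 2 * w + 1) ∧
      (∀ x y, step p x y → ρ y ≤ ρ x) ∧ (∀ x, Ω x.1.1 = p → Even (ρ x)) ∧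
      ∀ f : ℕ → X, (∀ n, step p (f n) (f (n + 1))) → ∃ n, Odd (ρ (f n)) := by
    intro p hp
    have hbad : FinitelyBad (step p) fun x => Ω x.1.1 = p := fun f hf =>
      winningState_finitelyBad hp f fun n => ⟨(hf n).1, (hf n).2.1⟩
    exact hbad.exists_rank (sp := fun x => sp x.1.1) (lev := fun x => lev x.1.1)
      (fun x y hxy => hxy.2.2) (fun x y ⟨⟨e, he⟩, _⟩ => hstep_lev he) hfin hw
  choose! ρ hρ_le hρ_step hρ_even hρ_odd using hrank
  let good : ℕ → X → Prop := fun p x => Odd (ρ p x) ∨ p < Ω x.1.1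
  have hful : ∀ p x, ∃ n, Odd p → FulfilledIn (step p) (good p) n x := by
    intro p x
    by_cases hp : Odd p
    · obtain ⟨n, hn⟩ := exists_fulfilledIn (step := step p) (good := good p)
        (fun x => (hfin (sp x.1.1) (lev x.1.1 + 1)).subset fun y ⟨⟨e, he⟩, hy⟩ =>
          ⟨hy.2, hstep_lev he⟩)
        (fun f hf => (hρ_odd p hp f hf).imp fun n hn => Or.inl hn) x
      exact ⟨n, fun _ => hn⟩
    · exact ⟨0, fun h => absurd h hp⟩
  choose g hg using hful
  have hT : ∀ s l, ∃ n, ∀ x : X, sp x.1.1 = s → lev x.1.1 = l → ∀ p : Fin (d + 1), Odd p.1 →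
      FulfilledIn (step p) (good p) n x := by
    intro s l
    obtain ⟨n, hn⟩ := ((hfin s l).image fun x => Finset.univ.sup fun p : Fin (d + 1) =>
      g p x).bddAbove
    exact ⟨n, fun x hx hx' p hp => (hg p x hp).mono
      ((Finset.le_sup (f := fun p : Fin (d + 1) => g p x) (Finset.mem_univ p)).trans
        (hn ⟨x, ⟨hx, hx'⟩, rfl⟩))⟩
  choose T hT using hT
  let left : X → ℕ := fun x => timeLeft (T (sp x.1.1)) (lev x.1.1)
  let pending : X → X → Finset (Fin (d + 1)) → Finset (Fin (d + 1)) := fun x y P =>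
    if sp y.1.1 = sp x.1.1 then
      if left x = 0 then Finset.univ.filter fun p => Odd p.1
      else P.filter fun p => ¬ good p x
    else ∅
  let Y := {z : X × Finset (Fin (d + 1)) // ∀ p ∈ z.2, Odd p.1 ∧
    FulfilledIn (step p) (good p) (left z.1) z.1}
  have hpending : ∀ (z : Y) (e : E) (y : X), StateStep A S z.1.1.1 e y.1 →
      ∀ p ∈ pending z.1.1 y z.1.2, Odd p.1 ∧ FulfilledIn (step p) (good p) (left y) y := by
    rintro ⟨⟨x, P⟩, hP⟩ e y hxy p hp
    simp only at hxy hp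
    by_cases hs : sp y.1.1 = sp x.1.1
    · have hl := hstep_lev hxy
      by_cases h0 : left x = 0
      · simp only [pending, if_pos hs, if_pos h0, Finset.mem_filter, Finset.mem_univ,
          true_and] at hp
        have hleft : left y = T (sp y.1.1) (lev y.1.1) := by
          simp only [left] at h0 ⊢
          rw [hl, hs]
          exact if_pos h0
        rw [hleft]
        exact ⟨hp, hT _ _ y rfl rfl p hp⟩
      · simp only [pending, if_pos hs, if_neg h0, Finset.mem_filter] at hp
        have hleft : left x = left y + 1 := by
          have : left y = left x - 1 := by
            simp only [left] at h0 ⊢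
            rw [hl, hs]
            exact if_neg h0
          omega
        obtain ⟨hodd, hF⟩ := hP p hp.1
        refine ⟨hodd, ?_⟩
        simp only at hF
        rw [hleft] at hF
        exact hF.resolve_left hp.2 y ⟨⟨e, hxy⟩, not_lt.1 fun hlt => hp.2 (Or.inr hlt), hs⟩
    · simp [pending, if_neg hs] at hp
  let C : Cover A Y (Finset (Fin (d + 1))) :=
    { pr := fun z => z.1.1.1.1
      bit := fun z => z.1.2
      edge := fun z e z' => StateStep A S z.1.1.1 e z'.1.1.1 ∧
        z'.1.2 = pending z.1.1 z'.1.1 z.1.2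
      src_eq := fun _ _ _ hz => hz.1.1
      tgt_eq := fun _ _ _ hz => by rw [hz.1.2.2]
      exists_of_eve := fun z _ => by
        obtain ⟨e, y, hy⟩ := exists_stateStep hS hE z.1.1.1
        exact ⟨e, ⟨(⟨y, z.1.1.2.step hy⟩, _), hpending z e _ hy⟩, hy, rfl⟩
      exists_of_not_eve := fun z e hz he => by
        have hy : StateStep A S z.1.1.1 e _ := ⟨he, fun h => absurd h hz, rfl⟩
        exact ⟨⟨(⟨_, z.1.1.2.step hy⟩, _), hpending z e _ hy⟩, hy, rfl⟩ }
  let val : Fin k ⊕ Fin (d + 1) → Y → ℕ := fun q z => q.elim (fun j => N - z.1.1.1.2.2 j)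
    fun p => if Odd p.1 then ρ p.1 z.1.1 else 0
  let reset : E → Fin k ⊕ Fin (d + 1) → Prop := fun e q => q.elim
    (fun j => A.act e j = CAct.reset)
    fun p => p.1 < Ω (A.src e) ∨ sp (A.tgt e) ≠ sp (A.src e)
  let z₀ : Y := ⟨(⟨_, winningState_init h⟩, ∅), by simp⟩
  obtain ⟨S', hvalid, hrun⟩ := C.exists_strategy hE z₀ reset val (by
    rintro x e y (j | p) hxy hr
    · simp only [val, Sum.elim_inl]
      rw [hxy.1.2.2]
      exact Nat.sub_le_sub_left (le_updC hr) _
    · simp only [val, Sum.elim_inr]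
      split_ifs with hp
      · simp only [reset, Sum.elim_inr, not_or, not_lt, not_not] at hr
        rw [hxy.1.1] at hr
        refine hρ_step p hp _ _ ⟨⟨e, hxy.1⟩, hr.1, ?_⟩
        rw [← hr.2, hxy.1.2.2]
      · exact le_rfl)
  have hval_le : ∀ q z, val q z ≤ N + (2 * w + 1) := by
    rintro (j | p) z
    · simp only [val, Sum.elim_inl]
      omega
    · simp only [val, Sum.elim_inr]
      split_ifs with hp
      · have := hρ_le p hp z.1.1
        omega
      · exact Nat.zero_le _
  refine ⟨S', hvalid, fun π hπ0 hpath hcons => ?_⟩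
  obtain ⟨x, y, τ, hrec, -, hpr, hedge, hbit⟩ := hrun π hπ0 hpath hcons
  have hlen : ∀ n, (τ n).length ≤ k + (d + 1) := fun n => by
    simpa using (hrec.nodup n).length_le_card
  have hcount_le : ∀ (z : Y) j, z.1.1.1.2.2 j ≤ N := fun z j => z.1.1.2.counter_le hS hE j
  constructor
  · intro j n
    let pot : ℕ → ℕ := fun n =>
      potential val (N + (2 * w + 1)) (k + (d + 1)) (Sum.inl j) (τ n) (x n)
    have hpot : ∀ n, pot n ≤ growth (k + (d + 1)) (N + (2 * w + 1)) := fun n =>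
      potential_le hval_le (hlen n) _
    have hinv : ∀ n, A.cval π j n + N * pot n ≤ (x n).1.1.1.2.2 j +
        N * growth (k + (d + 1)) (N + (2 * w + 1)) := by
      intro n
      induction n with
      | zero =>
        have := Nat.mul_le_mul_left N (hpot 0)
        rw [Arena.cval]
        omega
      | succ n ih =>
        have hpot' := Nat.mul_le_mul_left N (hpot (n + 1))
        by_cases hr : A.act (π n) j = CAct.reset
        · rw [Arena.cval, hr, updC]
          omega
        · have hy : (y n).1.1.1.2.2 j = updC ((x n).1.1.1.2.2 j) (A.act (π n) j) := by
            rw [(hedge n).1.2.2]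
          have hsucc : A.cval π j (n + 1) + (x n).1.1.1.2.2 j =
              A.cval π j n + (y n).1.1.1.2.2 j := by
            rw [hy, Arena.cval]
            cases hact : A.act (π n) j
            · simp [updC]
            · simp only [updC]
              omega
            · exact absurd hact hr
          have hyN := hcount_le (y n) j
          have hxN := hcount_le (x (n + 1)) j
          rcases hrec.potential_succ hval_le hlen (q := Sum.inl j) (n := n) hr with h1 | ⟨h1, h2⟩
          · have h3 : N * (pot (n + 1) + 1) ≤ N * pot n := Nat.mul_le_mul_left N h1
            rw [Nat.mul_succ] at h3
            omega
          · have h3 : N * pot (n + 1) ≤ N * pot n := Nat.mul_le_mul_left N h1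
            simp only [val, Sum.elim_inl] at h2
            omega
    have := hinv n
    have := hcount_le (x n) j
    rw [Nat.mul_add, Nat.mul_one]
    omega
  · refine paritySeq_of_odd_contradiction (d := d) (fun n => hΩ _) fun p hpd hp hi n₀ hn₀ => ?_
    have hsrc : ∀ n, (x n).1.1.1.1 = A.src (π n) := hpr
    obtain ⟨n₁, hn₁⟩ := hsp π hpath
    have hspine : ∀ n, n₁ ≤ n → sp (A.tgt (π n)) = sp (A.src (π n)) := fun n hn => by
      rw [hpath n, hn₁ _ (by omega), hn₁ n hn]
    obtain ⟨n₂, hn₂, hc⟩ := hrec.eventually_const (Sum.inr ⟨p, by omega⟩) (max n₀ n₁)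
      (fun n hn => by
        simp only [reset, Sum.elim_inr, not_or, not_lt, not_not]
        exact ⟨hn₀ n (by omega), hspine n (by omega)⟩)
    simp only [val, Sum.elim_inr, if_pos hp] at hc
    obtain ⟨n₃, hn₃, hpn⟩ := hi n₂
    have hconst : ∀ n, n₃ ≤ n → ρ p (x n).1.1 = ρ p (x n₃).1.1 := by
      intro n hn
      induction n, hn using Nat.le_induction with
      | base => rfl
      | succ n hn ih => rw [(hc n (by omega)).2, ih]
    have hbad : ∀ n, n₃ ≤ n → ¬ good p (x n).1.1 := by
      rintro n hn (hodd | hlt)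
      · rw [hconst n hn] at hodd
        exact Nat.not_even_iff_odd.2 hodd
          (hρ_even p hp _ (by rw [hsrc, hpn]))
      · rw [hsrc] at hlt
        have := hn₀ n (by omega)
        omega
    have hlevel : ∀ n i, lev (x (n + i)).1.1.1.1 = lev (x n).1.1.1.1 + i := by
      intro n i
      induction i with
      | zero => rfl
      | succ i ih =>
        have e : lev (x (n + i + 1)).1.1.1.1 = lev (x (n + i)).1.1.1.1 + 1 := by
          rw [hsrc, hsrc, ← hpath, hlev]
        rw [← add_assoc, ← add_assoc, e, ih]
    have hzero : ∀ n, n₃ ≤ n → ∃ i, left (x (n + i)).1.1 = 0 := by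
      intro n hn
      obtain ⟨i, hi⟩ := exists_timeLeft_eq_zero (T (sp (x n).1.1.1.1)) (lev (x n).1.1.1.1)
      refine ⟨i, ?_⟩
      have e : sp (x (n + i)).1.1.1.1 = sp (x n).1.1.1.1 := by
        rw [hsrc, hsrc, hn₁ (n + i) (by omega), hn₁ n (by omega)]
      simp only [left]
      rw [hlevel, e]
      exact hi
    have hmem : ∀ n, n₃ ≤ n → left (x n).1.1 = 0 ∨ (⟨p, by omega⟩ : Fin (d + 1)) ∈ (x n).1.2 →
        (⟨p, by omega⟩ : Fin (d + 1)) ∈ (x (n + 1)).1.2 := by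
      intro n hn hor
      have e1 : (x (n + 1)).1.2 = pending (x n).1.1 (y n).1.1 (x n).1.2 :=
        (hbit n).trans (hedge n).2
      have e2 : sp (y n).1.1.1.1 = sp (x n).1.1.1.1 := by
        rw [(hedge n).1.2.2, hsrc]
        exact hspine n (by omega)
      rw [e1]
      simp only [pending, if_pos e2]
      split_ifs with h0
      · simpa using hp
      · rw [Finset.mem_filter]
        exact ⟨hor.resolve_left h0, hbad n hn⟩
    obtain ⟨i, hi0⟩ := hzero n₃ le_rfl
    have hall : ∀ m, n₃ + i + 1 ≤ m → (⟨p, by omega⟩ : Fin (d + 1)) ∈ (x m).1.2 := by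
      intro m hm
      induction m, hm using Nat.le_induction with
      | base => exact hmem _ (by omega) (Or.inl hi0)
      | succ m hm ih => exact hmem m (by omega) (Or.inr ih)
    obtain ⟨i', hi'⟩ := hzero (n₃ + i + 1) (by omega)
    have hF := ((x (n₃ + i + 1 + i')).2 _ (hall _ (by omega))).2
    rw [hi'] at hF
    exact hbad _ (by omega) hF

/-- Memory states may be renamed and added. -/
theorem exists_strategy_fin [Finite M] {n : ℕ} (hn : Nat.card M ≤ n) (hS : S.Valid A) :
    ∃ S' : Strategy V E (Fin n), S'.Valid A ∧ ∀ π, S'.Consistent A π → S.Consistent A π := by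
  let f : M → Fin n := fun m => Fin.castLE hn (Finite.equivFin M m)
  let g : Fin n → M := fun i => if hi : i.1 < Nat.card M then (Finite.equivFin M).symm ⟨i, hi⟩
    else S.init
  have hgf : ∀ m, g (f m) = m := fun m => by
    simp [g, f]
  let S' : Strategy V E (Fin n) :=
    { init := f S.init
      update := fun i e => f (S.update (g i) e)
      move := fun v i => S.move v (g i) }
  refine ⟨S', fun v i => hS v (g i), fun π hcons n hn => ?_⟩
  have hmem : ∀ n, g (S'.memAt π n) = S.memAt π n := by
    intro n
    induction n with
    | zero => exact hgf _
    | succ n ih =>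
      rw [Strategy.memAt, Strategy.memAt, ← ih]
      exact hgf _
  rw [← hmem]
  exact hcons n hn

/-- The number of winning states of a strategy over a set of at most `W` vertices. -/
theorem ncard_winningState_le [Finite M] {W : ℕ} (hS : S.Valid A) (hE : ∀ v, ∃ e, A.src e = v)
    {s : Set V} (hs : s.Finite) (hsW : s.ncard ≤ W) :
    {x : {x // WinningState A Ω S N x} | x.1.1 ∈ s}.Finite ∧
      {x : {x // WinningState A Ω S N x} | x.1.1 ∈ s}.ncard ≤
        W * Nat.card (M × (Fin k → Fin (N + 1))) := by
  let f : {x // WinningState A Ω S N x} → V × (M × (Fin k → Fin (N + 1))) := fun x =>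
    (x.1.1, x.1.2.1, (winningCover A Ω S N hS hE).bit x)
  have hf : Function.Injective f := by
    rintro ⟨⟨v, m, c⟩, hx⟩ ⟨⟨v', m', c'⟩, hx'⟩ hff
    simp only [f, Prod.mk.injEq] at hff
    obtain ⟨rfl, rfl, hc⟩ := hff
    have : c = c' := funext fun j => congrArg Fin.val (congrFun hc j)
    subst this
    rfl
  have hmaps : ∀ x ∈ {x : {x // WinningState A Ω S N x} | x.1.1 ∈ s},
      f x ∈ s ×ˢ (Set.univ : Set (M × (Fin k → Fin (N + 1)))) := fun x hx => ⟨hx, trivial⟩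
  have hprod := hs.prod (Set.finite_univ (α := M × (Fin k → Fin (N + 1))))
  refine ⟨Set.Finite.of_injOn hmaps hf.injOn hprod, ?_⟩
  refine (Set.ncard_le_ncard_of_injOn f hmaps hf.injOn hprod).trans ?_
  rw [Set.ncard_prod, Set.ncard_univ]
  exact Nat.mul_le_mul_right _ hsW

end SmallMemory

/-- Theorem 5 of the paper: existence of a trade-off between
bounds and memory for B-parity games over thin tree arenas. There are functions
`mem : ℕ² → ℕ` and `α : ℕ⁴ → ℕ` such that for every B-parity game with `k`
counters and `d+1` colours over a thin tree arena of width `W` with initial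
vertex `v₀` such that `val(v₀) = N` is finite (i.e. some strategy of Eve
ensures `B(N) ∩ Parity(Ω)` from `v₀`), Eve has a strategy using
`W·3^k·k!·mem(d,k)` memory states ensuring `B(N^k · α(d,k,W,N)) ∩ Parity(Ω)`
from `v₀`. -/
theorem statement11 :
    ∃ (mem : ℕ → ℕ → ℕ) (α : ℕ → ℕ → ℕ → ℕ → ℕ),
      ∀ (V E : Type) (k d W : ℕ) (A : Arena V E k) (Ω : V → ℕ)
        (R : V → List Bool) (v₀ : V) (N : ℕ),
        (∀ v, Ω v ≤ d) →
        -- edges go from a node to one of its children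
        (∀ e : E, ∃ ℓ : Bool, R (A.tgt e) = R (A.src e) ++ [ℓ]) →
        -- R(V) is a tree: it is prefix-closed (it is nonempty since `v₀ : V`)
        (∀ l ∈ Set.range R, ∀ l' : List Bool, l' <+: l → l' ∈ Set.range R) →
        -- R(V) is thin: it has countably many infinite branches
        ({b : ℕ → Bool | ∀ n, prefixOf b n ∈ Set.range R}).Countable →
        -- width W: every node carries at most W vertices
        (∀ l : List Bool, {v : V | R v = l}.Finite ∧ {v : V | R v = l}.ncard ≤ W) →
        (∀ v : V, ∃ e : E, A.src e = v) →
        -- val(v₀) ≤ N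
        (∃ (M : Type) (S : Strategy V E M), S.Valid A ∧
          Ensures A S v₀ fun π => A.BoundedBy π N ∧ ParityPlay A Ω π) →
        ∃ S : Strategy V E (Fin (W * 3 ^ k * Nat.factorial k * mem d k)),
          S.Valid A ∧
          Ensures A S v₀ fun π => A.BoundedBy π (N ^ k * α d k W N) ∧ ParityPlay A Ω π := by
  classical
  let width : ℕ → ℕ → ℕ → ℕ → ℕ := fun d k W N =>
    W * Nat.card (((Fin k → Fin (N + 1)) × {τ : List (Fin (d + 1)) // τ.Nodup}) ×
      (Fin k → Fin (N + 1)))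
  refine ⟨fun d k => Nat.card (Finset (Fin (d + 1)) ×
      {τ : List (Fin k ⊕ Fin (d + 1)) // τ.Nodup}),
    fun d k W N => N * (1 + growth (k + (d + 1)) (N + (2 * width d k W N + 1))), ?_⟩
  intro V E k d W A Ω R v₀ N hΩ hR hpre hthin hW hE ⟨M, S, hS, hens⟩
  obtain ⟨S₁, hS₁, hens₁⟩ := exists_finite_memory_strategy hΩ hS hE hens
  obtain ⟨sp, hsp, hspw⟩ := exists_spine hpre hthin fun v => by
    obtain ⟨e, rfl⟩ := hE v
    exact ⟨_, hR e⟩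
  have hfib : ∀ s l, ∃ u : Set V, (u.Finite ∧ u.ncard ≤ W) ∧
      ∀ v, sp v = s → (R v).length = l → v ∈ u := by
    intro s l
    by_cases hex : ∃ v, sp v = s ∧ (R v).length = l
    · obtain ⟨v, hv, hv'⟩ := hex
      exact ⟨_, hW (R v), fun v' h h' => hsp v' v (h.trans hv.symm) (h'.trans hv'.symm)⟩
    · exact ⟨∅, by simp, fun v h h' => hex ⟨v, h, h'⟩⟩
  choose u hu hmem using hfib
  have hcard := fun s l => ncard_winningState_le (Ω := Ω) (N := N) hS₁ hE (hu s l).1 (hu s l).2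
  have hsub : ∀ s l, {x : {x // WinningState A Ω S₁ N x} | sp x.1.1 = s ∧ (R x.1.1).length = l} ⊆
      {x | x.1.1 ∈ u s l} := fun s l x hx => hmem s l _ hx.1 hx.2
  obtain ⟨S₂, hS₂, hens₂⟩ := exists_small_memory_strategy (w := width d k W N) hΩ hS₁ hE hens₁ sp
    (fun v => (R v).length)
    (fun e => by
      obtain ⟨ℓ, hℓ⟩ := hR e
      simp [hℓ])
    (fun π hπ => hspw (fun n => A.src (π n)) fun n => hπ n ▸ hR (π n))
    (fun s l => (hcard s l).1.subset (hsub s l))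
    (fun s l => (Set.ncard_le_ncard (hsub s l) (hcard s l).1).trans (hcard s l).2)
  have hWpos : 0 < W := by
    refine lt_of_lt_of_le ?_ (hW (R v₀)).2
    exact (Set.ncard_pos (hW (R v₀)).1).2 ⟨v₀, rfl⟩
  obtain ⟨S₃, hS₃, hcons⟩ := exists_strategy_fin (n := W * 3 ^ k * Nat.factorial k * Nat.card
    (Finset (Fin (d + 1)) × {τ : List (Fin k ⊕ Fin (d + 1)) // τ.Nodup}))
    (Nat.le_mul_of_pos_left _ (by positivity)) hS₂
  refine ⟨S₃, hS₃, fun π hπ0 hπ hπc => ?_⟩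
  obtain ⟨hb, hp⟩ := hens₂ π hπ0 hπ (hcons π hπc)
  refine ⟨fun j n => (hb j n).trans ?_, hp⟩
  rcases Nat.eq_zero_or_pos N with rfl | hN
  · simp
  · exact Nat.le_mul_of_pos_left _ (by positivity)
end

section
/- Let G be a word arena of width W and F a subset of its vertices such that every infinite path in G contains only finitely many vertices in F. Define X₀ = ∅ and, for i ≥ 0: X_{2i+1} is the set of vertices v such that every path from v contains no vertex of F before its first vertex in X_{2i}, if any; X_{2i+2} is the set of vertices v such that every path from v is finite or reaches X_{2i+1}. Then X₀ ⊆ X₁ ⊆ X₂ ⊆ …, and X_{2W} contains every vertex of G. -/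
/-- The sequence of sets of Lemma 2 of the paper: `X 0 = ∅`;
`X (2i+1)` is the set of vertices `v` such that every (finite) path from `v`
contains no vertex of `F` before its first vertex in `X (2i)`, if any;
`X (2i+2)` is the set of vertices `v` such that every path from `v` is finite
or reaches `X (2i+1)`. -/
def Xseq {V : Type} (edge : V → V → Prop) (F : Set V) : ℕ → Set V
  | 0 => ∅
  | n + 1 =>
    if n % 2 = 0 then
      -- `n + 1` is odd: safety rule
      {v | ∀ (π : ℕ → V) (m : ℕ), π 0 = v → (∀ l, l < m → edge (π l) (π (l + 1))) →
        π m ∈ F → ∃ m', m' ≤ m ∧ π m' ∈ Xseq edge F n}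
    else
      -- `n + 1` is even: every infinite path reaches `Xseq n`
      {v | ∀ π : ℕ → V, π 0 = v → (∀ l, edge (π l) (π (l + 1))) →
        ∃ m, π m ∈ Xseq edge F n}

section WordArena

variable {V : Type} {edge : V → V → Prop} {F : Set V}

theorem mem_Xseq_odd {i : ℕ} {v : V} :
    v ∈ Xseq edge F (2 * i + 1) ↔
      ∀ (π : ℕ → V) (m : ℕ), π 0 = v → (∀ l, l < m → edge (π l) (π (l + 1))) →
        π m ∈ F → ∃ m', m' ≤ m ∧ π m' ∈ Xseq edge F (2 * i) := by
  rw [Xseq, if_pos (by omega)]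
  rfl

theorem mem_Xseq_even {i : ℕ} {v : V} :
    v ∈ Xseq edge F (2 * (i + 1)) ↔
      ∀ π : ℕ → V, π 0 = v → (∀ l, edge (π l) (π (l + 1))) →
        ∃ m, π m ∈ Xseq edge F (2 * i + 1) := by
  rw [show 2 * (i + 1) = (2 * i + 1) + 1 by ring, Xseq, if_neg (by omega)]
  rfl

theorem Xseq_subset_succ (n : ℕ) : Xseq edge F n ⊆ Xseq edge F (n + 1) := by
  intro v hv
  obtain ⟨i, rfl | rfl⟩ := Nat.even_or_odd' n
  · exact mem_Xseq_odd.2 fun π m h0 _ _ => ⟨0, Nat.zero_le m, h0 ▸ hv⟩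
  · exact mem_Xseq_even.2 fun π h0 _ => ⟨0, h0 ▸ hv⟩

theorem Xseq_mono : Monotone (Xseq edge F) :=
  monotone_nat_of_le_succ Xseq_subset_succ

/-- Outside a positive even set of the sequence, there is an infinite path staying outside. -/
theorem exists_path_avoiding_Xseq_even {i : ℕ} {v : V}
    (hv : v ∉ Xseq edge F (2 * (i + 1))) :
    ∃ π : ℕ → V, π 0 = v ∧ (∀ l, edge (π l) (π (l + 1))) ∧
      ∀ l, π l ∉ Xseq edge F (2 * (i + 1)) := by
  rw [mem_Xseq_even] at hv
  push Not at hv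
  obtain ⟨π, h0, hπ, hX⟩ := hv
  refine ⟨π, h0, hπ, fun l hl => ?_⟩
  obtain ⟨m, hm⟩ := mem_Xseq_even.1 hl (fun k => π (l + k)) rfl (fun k => hπ (l + k))
  exact hX _ hm

theorem mem_Xseq_odd_of_edge {i : ℕ} {v w : V} (hv : v ∈ Xseq edge F (2 * i + 1))
    (hv' : v ∉ Xseq edge F (2 * i)) (hvw : edge v w) : w ∈ Xseq edge F (2 * i + 1) := by
  refine mem_Xseq_odd.2 fun π m h0 hπ hm => ?_
  obtain ⟨m', hm', hX⟩ := mem_Xseq_odd.1 hv (fun l => Nat.casesOn l v π) (m + 1) rfl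
    (fun l hl => by
      cases l with
      | zero => simpa [h0] using hvw
      | succ l => exact hπ l (by omega)) hm
  cases m' with
  | zero => exact absurd hX hv'
  | succ k => exact ⟨k, by omega, hX⟩

/-- If every vertex of `S` has a successor in `S` and can reach `F` inside `S`, then `S` is empty
as soon as every infinite path visits `F` finitely often. -/
theorem eq_empty_of_forall_reaches
    (hF : ∀ π : ℕ → V, (∀ n, edge (π n) (π (n + 1))) → {n | π n ∈ F}.Finite) {S : Set V}
    (hsucc : ∀ v ∈ S, ∃ w ∈ S, edge v w)
    (hreach : ∀ v ∈ S, ∃ (π : ℕ → V) (m : ℕ), π 0 = v ∧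
      (∀ l, l < m → edge (π l) (π (l + 1))) ∧ π m ∈ F ∧ ∀ l, l ≤ m → π l ∈ S) :
    S = ∅ := by
  let R : ℕ × V → Prop := fun p => ∃ π : ℕ → V, π 0 = p.2 ∧
      (∀ l, l < p.1 → edge (π l) (π (l + 1))) ∧ π p.1 ∈ F ∧ ∀ l, l ≤ p.1 → π l ∈ S
  have step : ∀ s : {p // R p}, ∃ t : {p // R p}, edge s.1.2 t.1.2 ∧
      (s.1.1 = 0 ∨ s.1.1 = t.1.1 + 1) := by
    rintro ⟨⟨n, v⟩, π, h0, hπ, hm, hS⟩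
    dsimp only at h0 hπ hm hS
    cases n with
    | zero =>
      obtain ⟨w, hw, hvw⟩ := hsucc v (h0 ▸ hS 0 le_rfl)
      obtain ⟨ρ, m, hρ⟩ := hreach w hw
      exact ⟨⟨⟨m, w⟩, ρ, hρ⟩, hvw, Or.inl rfl⟩
    | succ n =>
      refine ⟨⟨⟨n, π 1⟩, fun l => π (l + 1), rfl, fun l hl => hπ _ (by omega), hm,
        fun l hl => hS _ (by omega)⟩, ?_, Or.inr rfl⟩
      simpa [h0] using hπ 0 (by omega)
  choose next hedge hnext using step
  by_contra hne
  obtain ⟨v, hv⟩ := Set.nonempty_iff_ne_empty.2 hne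
  obtain ⟨ρ, m, hρ⟩ := hreach v hv
  let s : ℕ → {p // R p} := fun k => next^[k] ⟨⟨m, v⟩, ρ, hρ⟩
  have hs : ∀ k, s (k + 1) = next (s k) := fun k => Function.iterate_succ_apply' _ _ _
  have hit : ∀ n k, (s k).1.1 = n → ∃ j, k ≤ j ∧ (s j).1.2 ∈ F := by
    intro n
    induction n with
    | zero =>
      intro k hk
      obtain ⟨π, h0, -, hm, -⟩ := (s k).2
      exact ⟨k, le_rfl, by rwa [hk, h0] at hm⟩
    | succ n ih =>
      intro k hk
      have h1 := hnext (s k)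
      rw [← hs] at h1
      obtain ⟨j, hj, hjF⟩ := ih (k + 1) (by omega)
      exact ⟨j, by omega, hjF⟩
  obtain ⟨B, hB⟩ := (hF (fun k => (s k).1.2) fun k => by rw [hs]; exact hedge _).bddAbove
  obtain ⟨j, hj, hjF⟩ := hit _ (B + 1) rfl
  have : j ≤ B := hB hjF
  omega

theorem rank_path {r : V → ℕ} (hchron : ∀ v v', edge v v' → r v' = r v + 1) {π : ℕ → V} {m : ℕ}
    (hπ : ∀ l, l < m → edge (π l) (π (l + 1))) : ∀ l, l ≤ m → r (π l) = r (π 0) + l := by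
  intro l
  induction l with
  | zero => simp
  | succ l ih =>
    intro hl
    rw [hchron _ _ (hπ l (by omega)), ih (by omega)]
    ring

/-- If some vertex lies outside `X₂`, then `X₂` has vertices of arbitrarily large rank. -/
theorem exists_rank_ge_mem_Xseq_two {r : V → ℕ} (hchron : ∀ v v', edge v v' → r v' = r v + 1)
    (hF : ∀ π : ℕ → V, (∀ n, edge (π n) (π (n + 1))) → {n | π n ∈ F}.Finite)
    {v : V} (hv : v ∉ Xseq edge F 2) (N : ℕ) : ∃ w, N ≤ r w ∧ w ∈ Xseq edge F 2 := by
  by_contra! h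
  have hempty : {w | N ≤ r w} = ∅ := by
    refine eq_empty_of_forall_reaches hF (fun w hw => ?_) (fun w hw => ?_)
    · obtain ⟨π, h0, hπ, -⟩ := exists_path_avoiding_Xseq_even (i := 0) (h w hw)
      have he : edge w (π 1) := h0 ▸ hπ 0
      refine ⟨π 1, ?_, he⟩
      have hw' : N ≤ r w := hw
      have := hchron _ _ he
      show N ≤ r (π 1)
      omega
    · have h1 : w ∉ Xseq edge F (2 * 0 + 1) := fun h1 => h w hw (Xseq_subset_succ 1 h1)
      rw [mem_Xseq_odd] at h1
      push Not at h1
      obtain ⟨π, m, h0, hπ, hm, -⟩ := h1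
      refine ⟨π, m, h0, hπ, hm, fun l hl => ?_⟩
      have hw' : N ≤ r w := hw
      have := rank_path hchron hπ l hl
      rw [h0] at this
      show N ≤ r (π l)
      omega
  obtain ⟨π, -, hπ, -⟩ := exists_path_avoiding_Xseq_even (i := 0) hv
  have hN : π N ∈ {w | N ≤ r w} := by
    have := rank_path hchron (m := N) (fun l _ => hπ l) N le_rfl
    show N ≤ r (π N)
    omega
  rw [hempty] at hN
  exact hN

/-- If some vertex lies outside `X_{2i+2}`, then from some rank on, each level contains a vertex
of `X_{2i+4}` outside `X_{2i+2}`. -/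
theorem exists_forall_rank_ge_mem_Xseq_diff {r : V → ℕ}
    (hchron : ∀ v v', edge v v' → r v' = r v + 1)
    (hF : ∀ π : ℕ → V, (∀ n, edge (π n) (π (n + 1))) → {n | π n ∈ F}.Finite)
    {i : ℕ} {v : V} (hv : v ∉ Xseq edge F (2 * (i + 1))) :
    ∃ N, ∀ n, N ≤ n → ∃ w, r w = n ∧ w ∉ Xseq edge F (2 * (i + 1)) ∧
      w ∈ Xseq edge F (2 * (i + 1 + 1)) := by
  obtain ⟨w, hw, hw'⟩ : ∃ w, w ∉ Xseq edge F (2 * (i + 1)) ∧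
      w ∈ Xseq edge F (2 * (i + 1) + 1) := by
    by_contra! h
    have hempty : (Xseq edge F (2 * (i + 1)))ᶜ = ∅ := by
      refine eq_empty_of_forall_reaches hF (fun w hw => ?_) (fun w hw => ?_)
      · obtain ⟨π, h0, hπ, hX⟩ := exists_path_avoiding_Xseq_even hw
        exact ⟨π 1, hX 1, h0 ▸ hπ 0⟩
      · have h1 := h w hw
        rw [mem_Xseq_odd] at h1
        push Not at h1
        exact h1
    exact (hempty ▸ hv : v ∈ (∅ : Set V))
  obtain ⟨π, h0, hπ, hX⟩ := exists_path_avoiding_Xseq_even hw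
  have hodd : ∀ l, π l ∈ Xseq edge F (2 * (i + 1) + 1) := by
    intro l
    induction l with
    | zero => rwa [h0]
    | succ l ih => exact mem_Xseq_odd_of_edge ih (hX l) (hπ l)
  refine ⟨r w, fun n hn => ⟨π (n - r w), ?_, hX _, Xseq_subset_succ _ (hodd _)⟩⟩
  rw [rank_path hchron (m := n - r w) (fun l _ => hπ l) _ le_rfl, h0]
  omega

theorem ncard_level_diff_lt {r : V → ℕ} {n : ℕ} (hfin : {v : V | r v = n}.Finite)
    {A B : Set V} (hAB : A ⊆ B) {w : V} (hw : r w = n) (hA : w ∉ A) (hB : w ∈ B) :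
    ({v : V | r v = n} \ B).ncard < ({v : V | r v = n} \ A).ncard := by
  refine Set.ncard_lt_ncard ⟨Set.sdiff_subset_sdiff_right hAB, fun h => ?_⟩ hfin.sdiff
  exact (h ⟨hw, hA⟩).2 hB

/-- As long as `X_{2i+2}` is not everything, infinitely many levels have at most `W - (i + 1)`
vertices outside it. -/
theorem exists_level_ncard_add_le {r : V → ℕ} {W : ℕ}
    (hchron : ∀ v v', edge v v' → r v' = r v + 1)
    (hwidth : ∀ i : ℕ, {v : V | r v = i}.Finite ∧ {v : V | r v = i}.ncard ≤ W)
    (hF : ∀ π : ℕ → V, (∀ n, edge (π n) (π (n + 1))) → {n | π n ∈ F}.Finite)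
    {v : V} (i : ℕ) (hv : v ∉ Xseq edge F (2 * (i + 1))) (N : ℕ) :
    ∃ n, N ≤ n ∧ ({v : V | r v = n} \ Xseq edge F (2 * (i + 1))).ncard + (i + 1) ≤ W := by
  induction i generalizing N with
  | zero =>
    obtain ⟨w, hw, hX⟩ := exists_rank_ge_mem_Xseq_two hchron hF hv N
    refine ⟨r w, hw, ?_⟩
    have h1 := ncard_level_diff_lt (hwidth (r w)).1 (Set.empty_subset (Xseq edge F 2)) rfl
      (Set.notMem_empty w) hX
    rw [Set.sdiff_empty] at h1
    have h2 := (hwidth (r w)).2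
    simp only [zero_add, mul_one]
    omega
  | succ i ih =>
    have hsub : Xseq edge F (2 * (i + 1)) ⊆ Xseq edge F (2 * (i + 1 + 1)) :=
      Xseq_mono (by omega)
    have hv' := fun h => hv (hsub h)
    obtain ⟨M, hM⟩ := exists_forall_rank_ge_mem_Xseq_diff hchron hF hv'
    obtain ⟨n, hn, hcard⟩ := ih hv' (max N M)
    obtain ⟨w, hw, hA, hB⟩ := hM n (le_of_max_le_right hn)
    have := ncard_level_diff_lt (hwidth n).1 hsub hw hA hB
    exact ⟨n, le_of_max_le_left hn, by omega⟩

end WordArena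

/-- Lemma 2 of the paper. Let `G` be a word arena of width
`W` and `F` a set of vertices such that every infinite path in `G` contains
only finitely many vertices in `F`. Then `X₀ ⊆ X₁ ⊆ X₂ ⊆ ⋯` and `X_{2W}`
contains every vertex of `G`. -/
theorem statement13 {V : Type} (edge : V → V → Prop) (r : V → ℕ) (W : ℕ)
    (hchron : ∀ v v', edge v v' → r v' = r v + 1)
    (hwidth : ∀ i : ℕ, {v : V | r v = i}.Finite ∧ {v : V | r v = i}.ncard ≤ W)
    (F : Set V)
    (hF : ∀ π : ℕ → V, (∀ n, edge (π n) (π (n + 1))) → {n | π n ∈ F}.Finite) :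
    (∀ n, Xseq edge F n ⊆ Xseq edge F (n + 1)) ∧
    (∀ v : V, v ∈ Xseq edge F (2 * W)) := by
  refine ⟨Xseq_subset_succ, fun v => ?_⟩
  cases W with
  | zero =>
    have h := (Set.ncard_eq_zero (hwidth (r v)).1).1 (Nat.le_zero.1 (hwidth (r v)).2)
    exact absurd (show v ∈ {u | r u = r v} from rfl) (h ▸ Set.notMem_empty v)
  | succ i =>
    by_contra hv
    obtain ⟨n, hn, hcard⟩ := exists_level_ncard_add_le hchron hwidth hF i hv (r v)
    obtain ⟨π, h0, hπ, hX⟩ := exists_path_avoiding_Xseq_even hv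
    have hr := rank_path hchron (m := n - r v) (fun l _ => hπ l) _ le_rfl
    rw [h0] at hr
    have h := (Set.ncard_eq_zero (hwidth n).1.sdiff).1 (by omega :
      ({v : V | r v = n} \ Xseq edge F (2 * (i + 1))).ncard = 0)
    have hmem : π (n - r v) ∈ {v : V | r v = n} \ Xseq edge F (2 * (i + 1)) :=
      ⟨show r (π (n - r v)) = n by omega, hX _⟩
    rw [h] at hmem
    exact hmem
end

section
/- Let w = w₁ w₂ ⋯ w_n w_∞ be an infinite sequence of counter actions over k counters, factored into finite blocks w₁,…,w_n and an infinite tail w_∞, and let u = sum(w₁) sum(w₂) ⋯ sum(w_n) sum(w_∞) be the sequence of their summaries. Then val(u) ≤ val(w). -/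
/-- Value of counter `j` after reading `m` letters of the suffix of `w`
starting at position `a`, all counters starting at `0`. -/
def cvalFrom {k : ℕ} (w : ℕ → Fin k → CAct) (a : ℕ) (j : Fin k) : ℕ → ℕ
  | 0 => 0
  | m + 1 => updC (cvalFrom w a j m) (w (a + m) j)

/-- The value of an infinite sequence of counter actions: the supremum of all
counter values reached (in `ℕ∞`). -/
noncomputable def seqVal {k : ℕ} (w : ℕ → Fin k → CAct) : ℕ∞ :=
  ⨆ (j : Fin k) (m : ℕ), (cvalFrom w 0 j m : ℕ∞)

open Classical in
/-- The summary of the finite block `w[a..b)`: for each counter, `r` if it is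
reset in the block, `i` if it is incremented but not reset, `ε` otherwise. -/
noncomputable def blockSummary {k : ℕ} (w : ℕ → Fin k → CAct) (a b : ℕ) :
    Fin k → CAct := fun j =>
  if ∃ m, a ≤ m ∧ m < b ∧ w m j = CAct.reset then CAct.reset
  else if ∃ m, a ≤ m ∧ m < b ∧ w m j = CAct.inc then CAct.inc
  else CAct.eps

open Classical in
/-- The summary of the infinite tail `w[a..∞)`: for each counter, `r` if it is
reset in the tail, `i` if it is incremented but not reset, `ε` otherwise. -/
noncomputable def tailSummary {k : ℕ} (w : ℕ → Fin k → CAct) (a : ℕ) :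
    Fin k → CAct := fun j =>
  if ∃ m, a ≤ m ∧ w m j = CAct.reset then CAct.reset
  else if ∃ m, a ≤ m ∧ w m j = CAct.inc then CAct.inc
  else CAct.eps

/-- Given the factorisation of `w` into the `n` finite blocks
`w[t 0 .. t 1), …, w[t (n-1) .. t n)` and the infinite tail `w[t n ..)`, the
word `u = sum(w₁) sum(w₂) ⋯ sum(w_n) sum(w_∞)` of their summaries (padded with
`ε` actions, which leave all counter values unchanged). -/
noncomputable def summarized {k : ℕ} (w : ℕ → Fin k → CAct) (t : ℕ → ℕ) (n : ℕ) :
    ℕ → Fin k → CAct := fun m =>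
  if m < n then blockSummary w (t m) (t (m + 1))
  else if m = n then tailSummary w (t n)
  else fun _ => CAct.eps

lemma cvalFrom_succ {k : ℕ} (w : ℕ → Fin k → CAct) (j : Fin k) (m : ℕ) :
    cvalFrom w 0 j (m + 1) = updC (cvalFrom w 0 j m) (w m j) := by
  simp [cvalFrom]

/-- A counter does not decrease along a block in which it is not reset. -/
lemma cvalFrom_le_of_no_reset {k : ℕ} (w : ℕ → Fin k → CAct) (j : Fin k) {a b : ℕ}
    (hab : a ≤ b) (h : ∀ m, a ≤ m → m < b → w m j ≠ CAct.reset) :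
    cvalFrom w 0 j a ≤ cvalFrom w 0 j b := by
  induction b, hab using Nat.le_induction with
  | base => exact le_rfl
  | succ b hb ih =>
    have h1 := ih fun m h1 h2 => h m h1 (by omega)
    have h2 := h b hb (by omega)
    rw [cvalFrom_succ]
    cases hw : w b j <;> simp_all [updC] <;> omega

/-- A counter strictly increases along a block in which it is incremented and not reset. -/
lemma cvalFrom_lt_of_inc {k : ℕ} (w : ℕ → Fin k → CAct) (j : Fin k) {a b m : ℕ}
    (ham : a ≤ m) (hmb : m < b) (hm : w m j = CAct.inc)
    (h : ∀ m, a ≤ m → m < b → w m j ≠ CAct.reset) :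
    cvalFrom w 0 j a < cvalFrom w 0 j b := by
  have h1 := cvalFrom_le_of_no_reset w j ham fun i hi hi' => h i hi (by omega)
  have h2 := cvalFrom_le_of_no_reset w j (Nat.succ_le_of_lt hmb)
    fun i hi hi' => h i (by omega) hi'
  rw [Nat.succ_eq_add_one, cvalFrom_succ, hm, updC] at h2
  omega

lemma updC_blockSummary_le {k : ℕ} (w : ℕ → Fin k → CAct) (j : Fin k) {a b c : ℕ}
    (hab : a ≤ b) (hc : c ≤ cvalFrom w 0 j a) :
    updC c (blockSummary w a b j) ≤ cvalFrom w 0 j b := by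
  unfold blockSummary
  split_ifs with hr hi
  · exact Nat.zero_le _
  · push Not at hr
    obtain ⟨m, h1, h2, h3⟩ := hi
    exact Nat.succ_le_of_lt (hc.trans_lt (cvalFrom_lt_of_inc w j h1 h2 h3 hr))
  · push Not at hr
    exact hc.trans (cvalFrom_le_of_no_reset w j hab hr)

lemma exists_updC_tailSummary_le {k : ℕ} (w : ℕ → Fin k → CAct) (j : Fin k) {a c : ℕ}
    (hc : c ≤ cvalFrom w 0 j a) :
    ∃ p, updC c (tailSummary w a j) ≤ cvalFrom w 0 j p := by
  unfold tailSummary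
  split_ifs with hr hi
  · exact ⟨0, Nat.zero_le _⟩
  · push Not at hr
    obtain ⟨m, h1, h2⟩ := hi
    exact ⟨m + 1, Nat.succ_le_of_lt (hc.trans_lt
      (cvalFrom_lt_of_inc w j h1 m.lt_succ_self h2 fun i hi _ => hr i hi))⟩
  · exact ⟨a, hc⟩

lemma cvalFrom_summarized_le {k n : ℕ} (w : ℕ → Fin k → CAct) (t : ℕ → ℕ)
    (hmono : ∀ i, i < n → t i ≤ t (i + 1)) (j : Fin k) (m : ℕ) (hm : m ≤ n) :
    cvalFrom (summarized w t n) 0 j m ≤ cvalFrom w 0 j (t m) := by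
  induction m with
  | zero => exact Nat.zero_le _
  | succ m ih =>
    rw [cvalFrom_succ, summarized, if_pos (by omega)]
    exact updC_blockSummary_le w j (hmono m (by omega)) (ih (by omega))

lemma exists_cvalFrom_summarized_le {k n : ℕ} (w : ℕ → Fin k → CAct) (t : ℕ → ℕ)
    (hmono : ∀ i, i < n → t i ≤ t (i + 1)) (j : Fin k) (m : ℕ) :
    ∃ p, cvalFrom (summarized w t n) 0 j m ≤ cvalFrom w 0 j p := by
  induction m with
  | zero => exact ⟨0, Nat.zero_le _⟩
  | succ m ih =>
    rcases lt_trichotomy m n with h | rfl | h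
    · exact ⟨_, cvalFrom_summarized_le w t hmono j (m + 1) h⟩
    · rw [cvalFrom_succ, summarized, if_neg (lt_irrefl m), if_pos rfl]
      exact exists_updC_tailSummary_le w j (cvalFrom_summarized_le w t hmono j m le_rfl)
    · rw [cvalFrom_succ, summarized, if_neg (by omega), if_neg (by omega)]
      exact ih

/-- item 1 of Fact 3 of the paper. Let
`w = w₁ w₂ ⋯ w_n w_∞` be an infinite sequence of counter actions over `k`
counters, factored into finite blocks `w₁, …, w_n` and an infinite tail `w_∞`,
and let `u = sum(w₁) sum(w₂) ⋯ sum(w_n) sum(w_∞)`. Then `val(u) ≤ val(w)`. -/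
theorem statement14 {k n : ℕ} (w : ℕ → Fin k → CAct) (t : ℕ → ℕ)
    (ht0 : t 0 = 0) (hmono : ∀ i, i < n → t i ≤ t (i + 1)) :
    seqVal (summarized w t n) ≤ seqVal w := by
  refine iSup_mono fun j => iSup_le fun m => ?_
  obtain ⟨p, hp⟩ := exists_cvalFrom_summarized_le w t hmono j m
  exact le_iSup_of_le p (by exact_mod_cast hp)
end

section
/- For every B-game with k counters over a well-founded arena (an arena admitting no infinite play) with initial vertex v₀ such that val(v₀) is finite, Eve has a strategy using k! memory states that ensures B(val(v₀)^k) from v₀. -/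
/-- Every finite play from `v₀` consistent with the strategy `S` keeps all
counter values at most `N` (this is the condition `B(N)` over a well-founded
arena, where all plays are finite). The finite play consists of the edges
`π 0, …, π n`. -/
def EnsuresBoundFin {V E M : Type} {k : ℕ} (A : Arena V E k) (S : Strategy V E M)
    (v₀ : V) (N : ℕ) : Prop :=
  ∀ (π : ℕ → E) (n : ℕ), A.src (π 0) = v₀ →
    (∀ m, m < n → A.tgt (π m) = A.src (π (m + 1))) →
    (∀ m, m ≤ n → A.eve (A.src (π m)) → π m = S.move (A.src (π m)) (S.memAt π m)) →
    ∀ (j : Fin k) (m : ℕ), m ≤ n + 1 → A.cval π j m ≤ N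

/-- Simultaneous update of all counters along an edge. -/
def Arena.updV {V E : Type} {k : ℕ} (A : Arena V E k) (c : Fin k → ℕ) (e : E) : Fin k → ℕ :=
  fun j => updC (c j) (A.act e j)

/-- The configurations (vertex, memory state, counter values) reachable from `v₀`
in plays consistent with `S`. -/
inductive Reach {V E M : Type} {k : ℕ} (A : Arena V E k) (S : Strategy V E M) (v₀ : V) :
    V → M → (Fin k → ℕ) → Prop
  | init : Reach A S v₀ v₀ S.init 0
  | step {m : M} {c : Fin k → ℕ} (e : E) : Reach A S v₀ (A.src e) m c →
      (A.eve (A.src e) → e = S.move (A.src e) m) →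
      Reach A S v₀ (A.tgt e) (S.update m e) (A.updV c e)

section Prefix

variable {V E M : Type} {k : ℕ}

theorem Arena.cval_congr (A : Arena V E k) {π ρ : ℕ → E} (j : Fin k) (n : ℕ)
    (h : ∀ i < n, π i = ρ i) : A.cval π j n = A.cval ρ j n := by
  induction n with
  | zero => rfl
  | succ n ih =>
    simp only [Arena.cval]
    rw [ih fun i hi => h i (by omega), h n (by omega)]

theorem Strategy.memAt_congr (S : Strategy V E M) {π ρ : ℕ → E} (n : ℕ)
    (h : ∀ i < n, π i = ρ i) : S.memAt π n = S.memAt ρ n := by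
  induction n with
  | zero => rfl
  | succ n ih =>
    simp only [Strategy.memAt]
    rw [ih fun i hi => h i (by omega), h n (by omega)]

theorem Reach.exists_play {A : Arena V E k} {S : Strategy V E M} {v₀ v : V} {m : M}
    {c : Fin k → ℕ} (h : Reach A S v₀ v m c) :
    ∃ (π : ℕ → E) (n : ℕ), (n = 0 → v = v₀ ∧ c = 0) ∧ (0 < n → A.src (π 0) = v₀) ∧
      (∀ i, i + 1 = n → A.tgt (π i) = v) ∧
      (∀ i, i + 1 < n → A.tgt (π i) = A.src (π (i + 1))) ∧
      (∀ i < n, A.eve (A.src (π i)) → π i = S.move (A.src (π i)) (S.memAt π i)) ∧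
      S.memAt π n = m ∧ ∀ j, A.cval π j n = c j := by
  induction h with
  | init =>
    refine ⟨fun _ => S.move v₀ S.init, 0, ?_⟩
    simp [Strategy.memAt, Arena.cval]
  | @step m c e _ he ih =>
    obtain ⟨π, n, h0, hs, ht, hp, hc, hm, hv⟩ := ih
    set ρ : ℕ → E := fun i => if i < n then π i else e with hρ
    have hlt : ∀ i < n, ρ i = π i := fun i hi => by simp [hρ, hi]
    have hn : ρ n = e := by simp [hρ]
    have hmem : ∀ i ≤ n, S.memAt ρ i = S.memAt π i := fun i hi =>
      S.memAt_congr i fun a ha => hlt a (by omega)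
    refine ⟨ρ, n + 1, by simp, fun _ => ?_, fun i hi => ?_, fun i hi => ?_, fun i hi => ?_, ?_,
      fun j => ?_⟩
    · rcases Nat.eq_zero_or_pos n with rfl | hpos
      · rw [hn, (h0 rfl).1]
      · rw [hlt 0 hpos, hs hpos]
    · obtain rfl : i = n := by omega
      rw [hn]
    · rcases Nat.lt_or_ge (i + 1) n with h | h
      · rw [hlt i (by omega), hlt _ h, hp i h]
      · obtain rfl : n = i + 1 := by omega
        rw [hlt i (by omega), hn, ht i rfl]
    · rw [hmem i (by omega)]
      rcases Nat.lt_or_ge i n with h | h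
      · rw [hlt i h]; exact hc i h
      · obtain rfl : i = n := by omega
        rw [hn, hm]; exact he
    · simp only [Strategy.memAt]
      rw [hmem n le_rfl, hm, hn]
    · simp only [Arena.cval, Arena.updV]
      rw [A.cval_congr j n hlt, hv, hn]

theorem Reach.le_of_ensures {A : Arena V E k} {S : Strategy V E M} {v₀ v : V} {m : M}
    {c : Fin k → ℕ} {N : ℕ} (hS : EnsuresBoundFin A S v₀ N) (h : Reach A S v₀ v m c)
    (j : Fin k) : c j ≤ N := by
  obtain ⟨π, n, h0, hs, -, hp, hc, -, hv⟩ := h.exists_play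
  cases n with
  | zero => simp [(h0 rfl).2]
  | succ n =>
    rw [← hv j]
    exact hS π n (hs n.succ_pos) (fun i hi => hp i (by omega)) (fun i hi => hc i (by omega))
      j (n + 1) le_rfl

theorem ensuresBoundFin_of_invariant {A : Arena V E k} {S : Strategy V E M} {v₀ : V} {K : ℕ}
    (I : V → M → (Fin k → ℕ) → Prop) (hinit : I v₀ S.init 0)
    (hstep : ∀ e m c, I (A.src e) m c → (A.eve (A.src e) → e = S.move (A.src e) m) →
      I (A.tgt e) (S.update m e) (A.updV c e))
    (hbound : ∀ v m c, I v m c → ∀ j, c j ≤ K) : EnsuresBoundFin A S v₀ K := by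
  intro π n h0 hp hc j m hm
  have key : ∀ i ≤ n, I (A.src (π i)) (S.memAt π i) (fun j => A.cval π j i) := by
    intro i
    induction i with
    | zero => intro _; rw [h0]; exact hinit
    | succ i ih =>
      intro hi
      rw [← hp i (by omega)]
      exact hstep _ _ _ (ih (by omega)) (hc i (by omega))
  rcases Nat.lt_or_ge n m with h | h
  · obtain rfl : m = n + 1 := by omega
    exact hbound _ _ _ (hstep _ _ _ (key n le_rfl) (hc n le_rfl)) j
  · exact hbound _ _ _ (key m h) j

/-- Eve can play from a region `W` of configurations in which she can stay, while remembering
only a memory state from which a configuration of the region is recomputed, as long as `J` relates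
the recomputed counter values to the real ones. -/
theorem exists_strategy_of_tracking [Nonempty E] {A : Arena V E k} {v₀ : V} {K : ℕ}
    (W : V → (Fin k → ℕ) → Prop)
    (hEve : ∀ v c, W v c → A.eve v → (∃ e, A.src e = v) →
      ∃ e, A.src e = v ∧ W (A.tgt e) (A.updV c e))
    (hAdam : ∀ e c, W (A.src e) c → ¬ A.eve (A.src e) → W (A.tgt e) (A.updV c e))
    (x : V → M → Fin k → ℕ) (m₀ : M) (next : M → E → M)
    (J : (Fin k → ℕ) → M → (Fin k → ℕ) → Prop)
    (hinit : W v₀ (x v₀ m₀) ∧ J (x v₀ m₀) m₀ 0)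
    (hstep : ∀ e m c, W (A.tgt e) (A.updV (x (A.src e) m) e) → J (x (A.src e) m) m c →
      W (A.tgt e) (x (A.tgt e) (next m e)) ∧
        J (x (A.tgt e) (next m e)) (next m e) (A.updV c e))
    (hbound : ∀ y m c, J y m c → ∀ j, c j ≤ K) :
    ∃ S : Strategy V E M, S.Valid A ∧ EnsuresBoundFin A S v₀ K := by
  have hmove : ∀ v m, ∃ e, (A.eve v → (∃ e, A.src e = v) → A.src e = v) ∧
      (A.eve v → (∃ e, A.src e = v) → W v (x v m) → W (A.tgt e) (A.updV (x v m) e)) := by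
    intro v m
    by_cases hv : A.eve v ∧ ∃ e, A.src e = v
    · by_cases hW : W v (x v m)
      · obtain ⟨e, he, he'⟩ := hEve v _ hW hv.1 hv.2
        exact ⟨e, fun _ _ => he, fun _ _ _ => he'⟩
      · obtain ⟨e, he⟩ := hv.2
        exact ⟨e, fun _ _ => he, fun _ _ h => absurd h hW⟩
    · exact ⟨Classical.arbitrary E, fun h h' => absurd ⟨h, h'⟩ hv,
        fun h h' => absurd ⟨h, h'⟩ hv⟩
  choose mv hmv hmvW using hmove
  refine ⟨⟨m₀, next, mv⟩, fun v m h h' => hmv v m h h',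
    ensuresBoundFin_of_invariant (fun v m c => W v (x v m) ∧ J (x v m) m c) hinit ?_
      fun v m c h => hbound _ _ _ h.2⟩
  rintro e m c ⟨hW, hJ⟩ he
  refine hstep e m c ?_ hJ
  by_cases hv : A.eve (A.src e)
  · have := hmvW (A.src e) m hv ⟨e, rfl⟩ hW
    have he' : e = mv (A.src e) m := he hv
    rwa [← he'] at this
  · exact hAdam e _ hW hv

end Prefix

/-- Lexicographic comparison of counter values, the counters being listed by decreasing
significance. -/
def LexLe {k : ℕ} (y x : Fin k → ℕ) : List (Fin k) → Prop
  | [] => True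
  | j :: l => y j < x j ∨ y j = x j ∧ LexLe y x l

theorem exists_lexLe_max {k N : ℕ} (l : List (Fin k)) (W : (Fin k → ℕ) → Prop)
    (hne : ∃ y, W y) (hN : ∀ y, W y → ∀ j, y j ≤ N) :
    ∃ x, W x ∧ ∀ y, W y → LexLe y x l := by
  induction l generalizing W with
  | nil => exact ⟨hne.choose, hne.choose_spec, fun _ _ => trivial⟩
  | cons j l ih =>
    obtain ⟨a, ⟨y₀, hy₀, rfl⟩, hmax⟩ : ∃ a, (∃ y, W y ∧ y j = a) ∧ ∀ y, W y → y j ≤ a := by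
      classical
      have hex : ∃ a, ∃ y, W y ∧ y j = a := ⟨_, hne.choose, hne.choose_spec, rfl⟩
      have hb : ∀ a, (∃ y, W y ∧ y j = a) → a ≤ N := by
        rintro _ ⟨y, hy, rfl⟩
        exact hN y hy j
      obtain ⟨b, hb'⟩ := hex
      refine ⟨Nat.findGreatest (fun a => ∃ y, W y ∧ y j = a) N,
        Nat.findGreatest_spec (P := fun a => ∃ y, W y ∧ y j = a) (hb b hb') hb', fun y hy => ?_⟩
      exact Nat.le_findGreatest (hN y hy j) ⟨y, hy, rfl⟩
    obtain ⟨x, ⟨hx, hxj⟩, hle⟩ := ih (fun y => W y ∧ y j = y₀ j) ⟨y₀, hy₀, rfl⟩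
      fun y hy => hN y hy.1
    refine ⟨x, hx, fun y hy => ?_⟩
    rcases (hmax y hy).lt_or_eq with h | h
    · exact Or.inl (by omega)
    · exact Or.inr ⟨by omega, hle y ⟨hy, h⟩⟩

/-- `Budget N K c d b l`: the counters `l`, listed by decreasing significance, with real values `c`
and remaining virtual increments `d`, fit below `K`, where `b` is the weight of the
more significant counters. -/
def Budget {k : ℕ} (N K : ℕ) (c d : Fin k → ℕ) : ℕ → List (Fin k) → Prop
  | _, [] => True
  | b, j :: l => c j + d j + b ≤ K ∧ Budget N K c d (N * b + (N - 1) * d j) l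

namespace Budget

variable {k N K : ℕ} {c d : Fin k → ℕ} {b : ℕ} {l : List (Fin k)}

theorem le (h : Budget N K c d b l) {j : Fin k} (hj : j ∈ l) : c j ≤ K := by
  induction l generalizing b with
  | nil => simp at hj
  | cons i l ih =>
    rcases List.mem_cons.1 hj with rfl | hj
    · have := h.1
      omega
    · exact ih h.2 hj

theorem mono_sublist (hN : 0 < N) {c' d' : Fin k → ℕ} {b' : ℕ} {l' : List (Fin k)}
    (h : Budget N K c d b l) (hl : l'.Sublist l) (hb : b' ≤ b)
    (hd : ∀ j ∈ l', c' j + d' j ≤ c j + d j ∧ d' j ≤ d j) : Budget N K c' d' b' l' := by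
  induction hl generalizing b b' with
  | slnil => trivial
  | cons i _ ih =>
    refine ih h.2 (hb.trans ?_) hd
    nlinarith [Nat.zero_le ((N - 1) * d i), Nat.zero_le b]
  | cons_cons i _ ih =>
    obtain ⟨h1, h2⟩ := hd i (by simp)
    refine ⟨?_, ih h.2 ?_ fun j hj => hd j (by simp [hj])⟩
    · have := h.1
      omega
    · gcongr

theorem append_full {F : List (Fin k)} (hF : ∀ j ∈ F, c j ≤ K ∧ d j = 0)
    (h : Budget N K c d 0 l) : Budget N K c d 0 (F ++ l) := by
  induction F with
  | nil => exact h
  | cons j F ih =>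
    obtain ⟨h1, h2⟩ := hF j (by simp)
    refine ⟨by omega, ?_⟩
    have := ih fun i hi => hF i (by simp [hi])
    simpa [h2] using this

theorem weight_step (hN : 0 < N) {t a : ℕ} (hb : N + b ≤ N ^ (t + 1)) (ha : a ≤ N) :
    N + (N * b + (N - 1) * a) ≤ N ^ (t + 1 + 1) := by
  obtain ⟨n, rfl⟩ : ∃ n, N = n + 1 := ⟨N - 1, by omega⟩
  rw [pow_succ _ (t + 1)]
  simp only [Nat.add_sub_cancel]
  nlinarith [Nat.mul_le_mul_right (n + 1) hb, Nat.mul_le_mul_left n ha]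

theorem append_reset (hN : 0 < N) {R : List (Fin k)} {t s : ℕ}
    (h : Budget N (N ^ s) c d b l) (hb : N + b ≤ N ^ (t + 1)) (hd : ∀ j, d j ≤ N)
    (hR : ∀ j ∈ R, c j = 0) (hlen : t + (l ++ R).length ≤ s) :
    Budget N (N ^ s) c d b (l ++ R) := by
  induction l generalizing b t with
  | nil =>
    clear h
    induction R generalizing b t with
    | nil => trivial
    | cons j R ih =>
      simp only [List.nil_append, List.length_cons] at hlen ih ⊢
      refine ⟨?_, ih (fun i hi => hR i (by simp [hi])) (weight_step hN hb (hd j)) (by omega)⟩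
      have h1 := hR j (by simp)
      have h2 := hd j
      have h3 : N ^ (t + 1) ≤ N ^ s := Nat.pow_le_pow_right hN (by omega)
      omega
  | cons j l ih =>
    simp only [List.cons_append, List.length_cons] at hlen ⊢
    exact ⟨h.1, ih h.2 (weight_step hN hb (hd j)) (by omega)⟩

theorem of_lt_weight {d' : Fin k → ℕ} {b' : ℕ} (h : Budget N K c d b l)
    (hb : b' + (N - 1) ≤ b) (hd : ∀ j ∈ l, 0 < d j) (hd' : ∀ j, d' j ≤ N) :
    Budget N K c d' b' l := by
  induction l generalizing b b' with
  | nil => trivial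
  | cons j l ih =>
    have h1 := hd j (by simp)
    have h2 := hd' j
    refine ⟨?_, ih h.2 ?_ fun i hi => hd i (by simp [hi])⟩
    · have := h.1
      omega
    · have h3 := Nat.mul_le_mul_left N hb
      have h4 : (N - 1) * (d' j + 1) ≤ (N - 1) * (N + d j) := Nat.mul_le_mul_left _ (by omega)
      nlinarith

/-- Passing to lexicographically larger virtual values preserves the budget, if the full
counters are the most significant ones. -/
theorem raise {x y : Fin k → ℕ} {F : List (Fin k)}
    (h : Budget N K c (fun j => N - y j) b (F ++ l)) (hlex : LexLe y x (F ++ l))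
    (hx : ∀ j, x j ≤ N) (hF : ∀ j ∈ F, y j = N) (hl : ∀ j ∈ l, y j < N) :
    Budget N K c (fun j => N - x j) b (F ++ l) := by
  induction F generalizing b with
  | nil =>
    simp only [List.nil_append] at h hlex ⊢
    induction l generalizing b with
    | nil => trivial
    | cons j l ih =>
      have hj := hl j (by simp)
      rcases hlex with hlt | ⟨heq, hlex⟩
      · refine ⟨?_, h.2.of_lt_weight ?_ (fun i hi => ?_) (fun i => Nat.sub_le _ _)⟩
        · have := h.1
          dsimp only at this ⊢
          omega
        · have h1 : (N - 1) * (N - x j + 1) ≤ (N - 1) * (N - y j) :=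
            Nat.mul_le_mul_left _ (by have := hx j; omega)
          dsimp only
          nlinarith
        · have := hl i (by simp [hi])
          omega
      · obtain ⟨h1, h2⟩ := h
        dsimp only at h1 h2
        rw [heq] at h1 h2
        exact ⟨h1, ih (fun i hi => hl i (by simp [hi])) h2 hlex⟩
  | cons j F ih =>
    have hj := hF j (by simp)
    have hxj := hx j
    rcases hlex with hlt | ⟨heq, hlex⟩
    · omega
    · obtain ⟨h1, h2⟩ := h
      dsimp only at h1 h2
      rw [heq] at h1 h2
      exact ⟨h1, ih h2 hlex fun i hi => hF i (by simp [hi])⟩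

end Budget

/-- The new order of the counters after the actions `a` led to the virtual values `y`: the full
counters become the most significant ones and the reset counters the least significant ones. -/
def reorder {k : ℕ} (N : ℕ) (a : Fin k → CAct) (y : Fin k → ℕ) (l : List (Fin k)) :
    List (Fin k) :=
  let l' := l.filter fun j => a j ≠ .reset
  l'.filter (fun j => y j = N) ++
    (l'.filter (fun j => ¬ y j = N) ++ l.filter fun j => a j = .reset)

theorem reorder_perm {k : ℕ} (N : ℕ) (a : Fin k → CAct) (y : Fin k → ℕ) (l : List (Fin k)) :
    (reorder N a y l).Perm l := by
  simp only [reorder, ← List.append_assoc]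
  have h1 := List.filter_append_perm (fun j => decide (y j = N))
    (l.filter fun j => decide (a j ≠ .reset))
  have h2 := List.filter_append_perm (fun j => decide (a j ≠ .reset)) l
  refine List.Perm.trans ?_ h2
  simpa using h1.append_right _

theorem Budget.reorder_updV {V E : Type} {k N : ℕ} (hN : 0 < N) (A : Arena V E k) (e : E)
    {c x z : Fin k → ℕ} {l : List (Fin k)} (hlen : l.length = k)
    (h : Budget N (N ^ k) c (fun j => N - x j) 0 l)
    (hy : ∀ j, A.updV x e j ≤ N) (hz : ∀ j, z j ≤ N)
    (hlex : LexLe (A.updV x e) z (reorder N (A.act e) (A.updV x e) l)) :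
    Budget N (N ^ k) (A.updV c e) (fun j => N - z j) 0
      (reorder N (A.act e) (A.updV x e) l) := by
  have hkeep : Budget N (N ^ k) (A.updV c e) (fun j => N - A.updV x e j) 0
      (l.filter fun j => A.act e j ≠ .reset) := by
    refine h.mono_sublist hN List.filter_sublist le_rfl fun j hj => ?_
    have ha : A.act e j ≠ .reset := by simpa using (List.mem_filter.1 hj).2
    have hyj := hy j
    dsimp only [Arena.updV] at hyj ⊢
    cases hact : A.act e j with
    | reset => exact absurd hact ha
    | _ =>
      simp only [hact, updC] at hyj ⊢
      omega
  have hpos : ∀ t, N ≤ N ^ (t + 1) := fun t => Nat.le_self_pow (by omega) N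
  have hlen' := (reorder_perm N (A.act e) (A.updV x e) l).length_eq
  refine Budget.raise ?_ hlex hz ?_ ?_
  · refine Budget.append_full (fun j hj => ?_) (Budget.append_reset hN (t := 0) ?_ (hpos 0)
      (fun j => Nat.sub_le _ _) ?_ ?_)
    · rw [List.mem_filter] at hj
      refine ⟨hkeep.le hj.1, ?_⟩
      have : A.updV x e j = N := by simpa using hj.2
      omega
    · exact hkeep.mono_sublist hN List.filter_sublist le_rfl fun j _ => ⟨le_rfl, le_rfl⟩
    · intro j hj
      have : A.act e j = .reset := by simpa using (List.mem_filter.1 hj).2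
      simp [Arena.updV, this, updC]
    · simp only [reorder, List.length_append] at hlen' ⊢
      omega
  · intro j hj
    simpa using (List.mem_filter.1 hj).2
  · intro j hj
    rcases List.mem_append.1 hj with hj | hj
    · have : ¬ A.updV x e j = N := by simpa using (List.mem_filter.1 hj).2
      have := hy j
      omega
    · have : A.act e j = .reset := by simpa using (List.mem_filter.1 hj).2
      simpa [Arena.updV, this, updC] using hN

theorem Budget.initial {k N : ℕ} (hN : 0 < N) {z : Fin k → ℕ} {l : List (Fin k)}
    (hlen : l.length = k) (hz : ∀ j, z j ≤ N) (hlex : LexLe 0 z l) :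
    Budget N (N ^ k) 0 (fun j => N - z j) 0 l := by
  refine Budget.raise (F := []) (y := 0) ?_ hlex hz (by simp) (by simpa using fun _ _ => hN)
  exact Budget.append_reset hN (l := []) (t := 0) trivial (by simp) (by simp) (by simp)
    (by simp [hlen])

/-- The `k!` orders of `k` counters, as memory states. -/
theorem exists_order_encoding (k : ℕ) :
    ∃ (ord : Fin k.factorial → List (Fin k)) (enc : List (Fin k) → Fin k.factorial),
      (∀ m, (ord m).Perm (List.finRange k)) ∧
        ∀ l, l.Perm (List.finRange k) → ord (enc l) = l := by
  have hnd := List.nodup_permutations (List.finRange k) (List.nodup_finRange k)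
  have hcard : k.factorial = (List.finRange k).permutations.length := by
    simp [List.length_permutations]
  let f := (finCongr hcard).trans (List.Nodup.getEquiv _ hnd)
  refine ⟨fun m => (f m).1, fun l =>
    if h : l ∈ (List.finRange k).permutations then f.symm ⟨l, h⟩ else ⟨0, k.factorial_pos⟩,
    fun m => List.mem_permutations.1 (f m).2, fun l hl => ?_⟩
  simp [List.mem_permutations.2 hl]

/-- Lemma 4 of the paper. For every B-game with `k` counters
over a well-founded arena (no infinite play) with initial vertex `v₀` such that
`val(v₀) = N` is finite (i.e. some strategy of Eve ensures `B(N)` from `v₀`),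
Eve has a strategy using `k!` memory states ensuring `B(N^k)` from `v₀`. -/
theorem statement16 {V E : Type} {k : ℕ} (A : Arena V E k) (v₀ : V) (N : ℕ)
    (hwf : ∀ π : ℕ → E, ¬ A.IsPath π)
    (hval : ∃ (M : Type) (S : Strategy V E M), S.Valid A ∧ EnsuresBoundFin A S v₀ N) :
    ∃ S : Strategy V E (Fin (Nat.factorial k)), S.Valid A ∧
      EnsuresBoundFin A S v₀ (N ^ k) := by
  obtain ⟨M, S, hS, hSN⟩ := hval
  have : Nonempty E := ⟨S.move v₀ S.init⟩
  have hEve : ∀ v c, (∃ m, Reach A S v₀ v m c) → A.eve v → (∃ e, A.src e = v) →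
      ∃ e, A.src e = v ∧ ∃ m, Reach A S v₀ (A.tgt e) m (A.updV c e) := by
    rintro v c ⟨m, hm⟩ hv hne
    have hsrc := hS v m hv hne
    exact ⟨S.move v m, hsrc, _, Reach.step (S.move v m) (by rwa [hsrc]) fun _ => by rw [hsrc]⟩
  have hAdam : ∀ e c, (∃ m, Reach A S v₀ (A.src e) m c) → ¬ A.eve (A.src e) →
      ∃ m, Reach A S v₀ (A.tgt e) m (A.updV c e) := by
    rintro e c ⟨m, hm⟩ hv
    exact ⟨_, Reach.step e hm fun h => absurd h hv⟩
  have hle : ∀ v c, (∃ m, Reach A S v₀ v m c) → ∀ j, c j ≤ N := by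
    rintro v c ⟨m, hm⟩
    exact hm.le_of_ensures hSN
  have h0 : ∃ m, Reach A S v₀ v₀ m 0 := ⟨_, Reach.init⟩
  obtain ⟨ord, enc, hord, henc⟩ := exists_order_encoding k
  rcases Nat.eq_zero_or_pos N with rfl | hN
  · refine exists_strategy_of_tracking (fun v c => ∃ m, Reach A S v₀ v m c) hEve hAdam
      (fun _ _ => 0) (enc []) (fun m _ => m) (fun _ _ c => c = 0) ⟨h0, rfl⟩ ?_ ?_
    · rintro e m c hW rfl
      have : A.updV 0 e = 0 := funext fun j => Nat.le_zero.1 (hle _ _ hW j)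
      rw [this] at hW
      exact ⟨hW, this⟩
    · rintro _ _ _ rfl j
      exact Nat.zero_le _
  · have hx : ∀ v m, ∃ x : Fin k → ℕ, ∀ y, (∃ s, Reach A S v₀ v s y) →
        (∃ s, Reach A S v₀ v s x) ∧ LexLe y x (ord m) := by
      intro v m
      by_cases hne : ∃ y, ∃ s, Reach A S v₀ v s y
      · obtain ⟨x, hx, hmax⟩ := exists_lexLe_max (ord m) _ hne (hle v)
        exact ⟨x, fun y hy => ⟨hx, hmax y hy⟩⟩
      · exact ⟨0, fun y hy => absurd ⟨y, hy⟩ hne⟩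
    choose x hx using hx
    have hlen : ∀ m, (ord m).length = k := fun m => by simpa using (hord m).length_eq
    refine exists_strategy_of_tracking (fun v c => ∃ m, Reach A S v₀ v m c) hEve hAdam
      x (enc []) (fun m e => enc (reorder N (A.act e) (A.updV (x (A.src e) m) e) (ord m)))
      (fun y m c => Budget N (N ^ k) c (fun j => N - y j) 0 (ord m)) ?_ ?_ ?_
    · obtain ⟨h1, h2⟩ := hx v₀ (enc []) 0 h0
      exact ⟨h1, Budget.initial hN (hlen _) (hle _ _ h1) h2⟩
    · intro e m c hW hJ
      obtain ⟨h1, h2⟩ := hx (A.tgt e)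
        (enc (reorder N (A.act e) (A.updV (x (A.src e) m) e) (ord m))) _ hW
      refine ⟨h1, ?_⟩
      rw [henc _ ((reorder_perm _ _ _ _).trans (hord m))] at h2 ⊢
      exact hJ.reorder_updV hN A e (hlen m) (hle _ _ hW) (hle _ _ h1) h2
    · intro y m c hJ j
      exact hJ.le ((hord m).mem_iff.2 (List.mem_finRange j))
end
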